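/- There exist γ > 0 and K₀ > 0 such that for every integer K > K₀ and every ε > 0 there is N₀ = N₀(K, ε) with the following property: for every integer N > N₀, if A is chosen uniformly at random from the independent sets of the graph 𝒢(N,K), then the probability that s(1.96; A_A) ≥ 1 + γ is at least 1 − ε (where A_A ⊆ 𝕋_K² is the union of the grid squares in A). -/

import Mathlib

open MeasureTheory Filter
open scoped ENNReal

noncomputable section

/-- The Haar measure on the `K × K` torus `𝕋_K² = ℝ²/(Kℤ²)` (total mass `K²`). -/
def torusVolume (K : ℝ) : Measure (AddCircle K × AddCircle K) :=
  if hK : 0 < K then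
    haveI : Fact (0 < K) := ⟨hK⟩
    (volume : Measure (AddCircle K × AddCircle K))
  else 0

/-- Normalized density of a subset of the torus `𝕋_K²`. -/
def density (K : ℝ) (A : Set (AddCircle K × AddCircle K)) : ℝ :=
  (torusVolume K A).toReal / K ^ 2

/-- Autocorrelation function `f(x; A) = δ(A ∩ (A - x))`. -/
def autocorr (K : ℝ) (A : Set (AddCircle K × AddCircle K))
    (x : AddCircle K × AddCircle K) : ℝ :=
  density K (A ∩ (fun y => y + x) ⁻¹' A)

/-- Radialized pair correlation function `f°(r; A)`. -/
def paircorr (K : ℝ) (A : Set (AddCircle K × AddCircle K)) (r : ℝ) : ℝ :=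
  (1 / (2 * Real.pi)) * ∫ θ in (0:ℝ)..(2 * Real.pi),
    autocorr K A (((r * Real.cos θ : ℝ) : AddCircle K), ((r * Real.sin θ : ℝ) : AddCircle K))

/-- Normalized pair correlation `s(r; A) = f°(r; A) / δ(A)²`. -/
def scorr (K : ℝ) (A : Set (AddCircle K × AddCircle K)) (r : ℝ) : ℝ :=
  paircorr K A r / density K A ^ 2

/-- The closed grid square `[j/N,(j+1)/N] × [k/N,(k+1)/N]`, viewed inside the torus `𝕋_K²`. -/
def gridSquare (K N : ℕ) (v : Fin (N * K) × Fin (N * K)) :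
    Set (AddCircle (K : ℝ) × AddCircle (K : ℝ)) :=
  {q | ∃ p : ℝ × ℝ, q = ((p.1 : AddCircle (K : ℝ)), (p.2 : AddCircle (K : ℝ))) ∧
        (v.1 : ℝ) / N ≤ p.1 ∧ p.1 ≤ ((v.1 : ℝ) + 1) / N ∧
        (v.2 : ℝ) / N ≤ p.2 ∧ p.2 ≤ ((v.2 : ℝ) + 1) / N}

/-- A subset of `𝕋_K²` is locally constant at scale `1/N` if it is a union of grid squares. -/
def LocallyConst (K N : ℕ) (A : Set (AddCircle (K : ℝ) × AddCircle (K : ℝ))) : Prop :=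
  ∃ S : Set (Fin (N * K) × Fin (N * K)), A = ⋃ v ∈ S, gridSquare K N v

/-- Euclidean distance on the torus `𝕋_K²`. -/
def torusDist {K : ℝ} (x y : AddCircle K × AddCircle K) : ℝ :=
  Real.sqrt (‖x.1 - y.1‖ ^ 2 + ‖x.2 - y.2‖ ^ 2)

/-- The graph `𝒢(N, K)` on grid squares: two distinct squares are adjacent iff one contains a
point `x` and the other a point `y` with `|x - y| = 1` in the torus. -/
def unitGraph (K N : ℕ) : SimpleGraph (Fin (N * K) × Fin (N * K)) :=
  SimpleGraph.fromRel fun v w =>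
    ∃ x ∈ gridSquare K N v, ∃ y ∈ gridSquare K N w, torusDist x y = 1

/-- The subset `A_F ⊆ 𝕋_K²` given by the union of the squares in `F`. -/
def unionSquares (K N : ℕ) (F : Finset (Fin (N * K) × Fin (N * K))) :
    Set (AddCircle (K : ℝ) × AddCircle (K : ℝ)) :=
  ⋃ v ∈ F, gridSquare K N v

/-- An independent set of a simple graph. -/
def IsIndep {V : Type*} (G : SimpleGraph V) (s : Finset V) : Prop :=
  ∀ a ∈ s, ∀ b ∈ s, ¬ G.Adj a b

end

open scoped Topology

noncomputable section

/-- The average of a real function over the circle of angles. -/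
def angleAvg (g : ℝ → ℝ) : ℝ := 1 / (2 * Real.pi) * ∫ θ in (0:ℝ)..(2 * Real.pi), g θ

/-- The Bessel function `J₀`. -/
def besselJ (t : ℝ) : ℝ := angleAvg fun θ => Real.cos (t * Real.cos θ)

/-- The Bessel function `J₁`. -/
def besselJOne (t : ℝ) : ℝ := angleAvg fun θ => Real.cos θ * Real.sin (t * Real.cos θ)

lemma angleAvg_mono {f g : ℝ → ℝ} (hf : Continuous f) (hg : Continuous g)
    (h : ∀ θ, f θ ≤ g θ) : angleAvg f ≤ angleAvg g := by
  unfold angleAvg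
  have hpi := Real.pi_pos
  refine mul_le_mul_of_nonneg_left ?_ (by positivity)
  exact intervalIntegral.integral_mono_on (by positivity) (hf.intervalIntegrable _ _)
    (hg.intervalIntegrable _ _) fun x _ => h x

lemma angleAvg_add {f g : ℝ → ℝ} (hf : Continuous f) (hg : Continuous g) :
    angleAvg (fun θ => f θ + g θ) = angleAvg f + angleAvg g := by
  unfold angleAvg
  rw [intervalIntegral.integral_add (hf.intervalIntegrable _ _) (hg.intervalIntegrable _ _), mul_add]

lemma angleAvg_const_mul (c : ℝ) (f : ℝ → ℝ) :
    angleAvg (fun θ => c * f θ) = c * angleAvg f := by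
  unfold angleAvg
  rw [intervalIntegral.integral_const_mul]; ring

lemma angleAvg_const (c : ℝ) : angleAvg (fun _ => c) = c := by
  unfold angleAvg
  have hpi := Real.pi_pos
  rw [intervalIntegral.integral_const]
  simp
  field_simp

lemma angleAvg_shift {g : ℝ → ℝ} (hg : Function.Periodic g (2 * Real.pi)) (φ : ℝ) :
    angleAvg (fun θ => g (θ + φ)) = angleAvg g := by
  unfold angleAvg
  congr 1
  rw [intervalIntegral.integral_comp_add_right, zero_add, add_comm (2 * Real.pi) φ,
    hg.intervalIntegral_add_eq φ 0, zero_add]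

lemma exists_polar (a b : ℝ) :
    ∃ φ, a = √(a ^ 2 + b ^ 2) * Real.cos φ ∧ b = √(a ^ 2 + b ^ 2) * Real.sin φ := by
  refine ⟨Complex.arg ⟨a, b⟩, ?_⟩
  have hn : ‖(⟨a, b⟩ : ℂ)‖ = √(a ^ 2 + b ^ 2) := by
    rw [Complex.norm_def, Complex.normSq_mk]; ring_nf
  rw [← hn]
  exact ⟨(Complex.norm_mul_cos_arg ⟨a, b⟩).symm, (Complex.norm_mul_sin_arg ⟨a, b⟩).symm⟩

lemma angleAvg_cos_linear (a b : ℝ) :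
    angleAvg (fun θ => Real.cos (a * Real.cos θ + b * Real.sin θ)) = besselJ (√(a ^ 2 + b ^ 2)) := by
  obtain ⟨φ, ha, hb⟩ := exists_polar a b
  set r := √(a ^ 2 + b ^ 2) with hr
  unfold besselJ
  rw [← angleAvg_shift (g := fun θ => Real.cos (r * Real.cos θ)) _ (-φ)]
  · congr 1
    ext θ
    congr 1
    rw [← sub_eq_add_neg, Real.cos_sub]
    conv_lhs => rw [ha, hb]
    ring
  · intro θ; simp

lemma besselJ_zero : besselJ 0 = 1 := by
  simp [besselJ, angleAvg_const]

lemma angleAvg_cos_sq : angleAvg (fun θ => Real.cos θ ^ 2) = 1 / 2 := by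
  unfold angleAvg
  have hpi := Real.pi_pos
  rw [integral_cos_sq]
  simp
  field_simp

lemma cos_interp (x y s : ℝ) (h0 : 0 ≤ s) (h1 : s ≤ 1) :
    (1 - s) * Real.cos x + s * Real.cos y - s * (1 - s) * (x - y) ^ 2 / 2 ≤
      Real.cos ((1 - s) * x + s * y) := by
  have hc : ConcaveOn ℝ Set.univ (fun x : ℝ => Real.cos x - x ^ 2 / 2) := by
    have hd : deriv (fun x : ℝ => Real.cos x - x ^ 2 / 2) = fun x => -Real.sin x - x := by
      ext x
      have : HasDerivAt (fun x : ℝ => Real.cos x - x ^ 2 / 2) (-Real.sin x - (2 * x) / 2) x := by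
        refine (Real.hasDerivAt_cos x).fun_sub (HasDerivAt.div_const ?_ 2)
        simpa using hasDerivAt_pow 2 x
      rw [this.deriv]; ring
    refine concaveOn_univ_of_deriv2_nonpos (by fun_prop) (by rw [hd]; fun_prop) fun x => ?_
    simp only [Function.iterate_succ, Function.iterate_zero, Function.comp, id]
    rw [hd]
    have : HasDerivAt (fun x : ℝ => -Real.sin x - x) (-Real.cos x - 1) x :=
      (Real.hasDerivAt_sin x).neg.sub (hasDerivAt_id x)
    rw [this.deriv]
    linarith [Real.neg_one_le_cos x]
  have := hc.2 (Set.mem_univ x) (Set.mem_univ y) (sub_nonneg.2 h1) h0 (by ring)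
  simp only [smul_eq_mul] at this
  nlinarith [this]

lemma besselJ_interp (x y s : ℝ) (h0 : 0 ≤ s) (h1 : s ≤ 1) :
    (1 - s) * besselJ x + s * besselJ y - s * (1 - s) * (x - y) ^ 2 / 4 ≤
      besselJ ((1 - s) * x + s * y) := by
  have := angleAvg_mono (f := fun θ => (1 - s) * Real.cos (x * Real.cos θ) +
      s * Real.cos (y * Real.cos θ) + (-(s * (1 - s) * (x - y) ^ 2 / 2)) * Real.cos θ ^ 2)
    (g := fun θ => Real.cos (((1 - s) * x + s * y) * Real.cos θ)) (by fun_prop) (by fun_prop)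
    (fun θ => by
      have := cos_interp (x * Real.cos θ) (y * Real.cos θ) s h0 h1
      calc _ = (1 - s) * Real.cos (x * Real.cos θ) + s * Real.cos (y * Real.cos θ)
            - s * (1 - s) * (x * Real.cos θ - y * Real.cos θ) ^ 2 / 2 := by ring
        _ ≤ _ := this
        _ = _ := by ring_nf)
  rw [angleAvg_add (by fun_prop) (by fun_prop), angleAvg_add (by fun_prop) (by fun_prop),
    angleAvg_const_mul, angleAvg_const_mul, angleAvg_const_mul, angleAvg_cos_sq] at this
  unfold besselJ
  linarith

lemma integral_cos_pow_two_mul (k : ℕ) :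
    angleAvg (fun θ => Real.cos θ ^ (2 * k)) = ((2 * k).factorial : ℝ) / (4 ^ k * (k.factorial : ℝ) ^ 2) := by
  induction k with
  | zero => simp [angleAvg_const]
  | succ k ih =>
    have h : angleAvg (fun θ => Real.cos θ ^ (2 * (k + 1))) =
        ((2 * k + 1 : ℝ) / (2 * k + 2)) * angleAvg (fun θ => Real.cos θ ^ (2 * k)) := by
      unfold angleAvg
      rw [show 2 * (k + 1) = 2 * k + 2 by ring, integral_cos_pow]
      simp
      ring
    rw [h, ih, show 2 * (k + 1) = 2 * k + 1 + 1 by ring, Nat.factorial_succ, Nat.factorial_succ,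
      Nat.factorial_succ]
    push_cast
    have : (k.factorial : ℝ) ≠ 0 := by positivity
    field_simp
    ring

lemma hasSum_besselJ (t : ℝ) :
    HasSum (fun k : ℕ => (-1) ^ k * (t ^ 2 / 4) ^ k / (k.factorial : ℝ) ^ 2) (besselJ t) := by
  have hs : Summable fun k : ℕ => |t| ^ (2 * k) / ((2 * k).factorial : ℝ) :=
    (Real.summable_pow_div_factorial |t|).comp_injective
      (mul_right_injective₀ (two_ne_zero : (2:ℕ) ≠ 0))
  have := intervalIntegral.hasSum_integral_of_dominated_convergence (μ := volume)
    (a := 0) (b := 2 * Real.pi) (f := fun θ => Real.cos (t * Real.cos θ))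
    (F := fun (k : ℕ) θ => (-1) ^ k * (t * Real.cos θ) ^ (2 * k) / ((2 * k).factorial : ℝ))
    (fun k _ => |t| ^ (2 * k) / ((2 * k).factorial : ℝ))
    (fun k => by
      apply Continuous.aestronglyMeasurable
      fun_prop)
    (fun k => Eventually.of_forall fun θ _ => by
      rw [Real.norm_eq_abs, abs_div, abs_mul, abs_pow, abs_neg, abs_one, one_pow, one_mul, abs_pow,
        abs_mul, Nat.abs_cast]
      gcongr
      exact mul_le_of_le_one_right (abs_nonneg t) (Real.abs_cos_le_one θ))
    (Eventually.of_forall fun θ _ => hs)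
    (by simp)
    (Eventually.of_forall fun θ _ => Real.hasSum_cos _)
  have h2 := this.mul_left (1 / (2 * Real.pi))
  refine h2.congr_fun fun k => ?_
  have h3 := integral_cos_pow_two_mul k
  rw [angleAvg] at h3
  simp_rw [mul_pow, ← mul_assoc, div_eq_mul_inv, mul_right_comm _ _ (((2 * k).factorial : ℝ)⁻¹)]
  rw [intervalIntegral.integral_const_mul, mul_left_comm, ← div_eq_mul_inv (1 : ℝ) (2 * Real.pi), h3]
  have : ((2 * k).factorial : ℝ) ≠ 0 := by positivity
  have : (k.factorial : ℝ) ≠ 0 := by positivity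
  rw [pow_mul, ← one_div, mul_pow, one_div_pow]
  field_simp

end

lemma hasDerivAt_angleAvg {F F' : ℝ → ℝ → ℝ} (hF : ∀ t, Continuous (F t))
    (hF' : ∀ t, Continuous (F' t)) (hb : ∀ t θ, |F' t θ| ≤ 1)
    (hd : ∀ t θ, HasDerivAt (fun t => F t θ) (F' t θ) t) (t : ℝ) :
    HasDerivAt (fun t => angleAvg (F t)) (angleAvg (F' t)) t := by
  unfold angleAvg
  refine HasDerivAt.const_mul _ ?_
  refine (intervalIntegral.hasDerivAt_integral_of_dominated_loc_of_deriv_le (s := Set.univ)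
    (bound := fun _ => 1) univ_mem (Eventually.of_forall fun t => (hF t).aestronglyMeasurable)
    ((hF t).intervalIntegrable _ _) (hF' t).aestronglyMeasurable
    (Eventually.of_forall fun θ _ t _ => hb t θ) (by simp)
    (Eventually.of_forall fun θ _ t _ => hd t θ)).2

lemma hasDerivAt_besselJ (t : ℝ) : HasDerivAt besselJ (-besselJOne t) t := by
  have := hasDerivAt_angleAvg (F := fun t θ => Real.cos (t * Real.cos θ))
    (F' := fun t θ => (-1) * (Real.cos θ * Real.sin (t * Real.cos θ))) (fun t => by fun_prop)
    (fun t => by fun_prop)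
    (fun t θ => by
      rw [abs_mul, abs_mul, abs_neg, abs_one, one_mul]
      exact mul_le_one₀ (Real.abs_cos_le_one _) (abs_nonneg _) (Real.abs_sin_le_one _))
    (fun t θ => by
      have := ((hasDerivAt_id t).mul_const (Real.cos θ)).cos
      exact this.congr_deriv (by simp; ring)) t
  rw [angleAvg_const_mul, neg_one_mul] at this
  exact this

lemma hasDerivAt_besselJOne' (t : ℝ) : HasDerivAt besselJOne
    (angleAvg fun θ => Real.cos θ ^ 2 * Real.cos (t * Real.cos θ)) t := by
  refine hasDerivAt_angleAvg (F := fun t θ => Real.cos θ * Real.sin (t * Real.cos θ))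
    (F' := fun t θ => Real.cos θ ^ 2 * Real.cos (t * Real.cos θ)) (fun t => by fun_prop)
    (fun t => by fun_prop)
    (fun t θ => ?_)
    (fun t θ => ?_) t
  · rw [abs_mul, abs_pow]
    exact mul_le_one₀ (pow_le_one₀ (abs_nonneg _) (Real.abs_cos_le_one _)) (abs_nonneg _)
      (Real.abs_cos_le_one _)
  · have := (((hasDerivAt_id t).mul_const (Real.cos θ)).sin).const_mul (Real.cos θ)
    exact this.congr_deriv (by simp; ring)

lemma besselJOne_eq (t : ℝ) :
    besselJOne t = t * (besselJ t - angleAvg fun θ => Real.cos θ ^ 2 * Real.cos (t * Real.cos θ)) := by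
  have h : angleAvg (fun θ => Real.cos θ * Real.sin (t * Real.cos θ) +
      (-t) * (Real.cos (t * Real.cos θ) + (-1) * (Real.cos θ ^ 2 * Real.cos (t * Real.cos θ)))) = 0 := by
    unfold angleAvg
    rw [intervalIntegral.integral_eq_sub_of_hasDerivAt
      (f := fun θ => Real.sin θ * Real.sin (t * Real.cos θ))]
    · simp
    · intro θ _
      have := (Real.hasDerivAt_sin θ).mul (((Real.hasDerivAt_cos θ).const_mul t).sin)
      refine this.congr_deriv ?_
      linear_combination (-t * Real.cos (t * Real.cos θ)) * Real.sin_sq_add_cos_sq θ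
    · apply Continuous.intervalIntegrable
      fun_prop
  rw [angleAvg_add (by fun_prop) (by fun_prop), angleAvg_const_mul,
    angleAvg_add (by fun_prop) (by fun_prop), angleAvg_const_mul] at h
  unfold besselJOne besselJ
  linarith

lemma hasDerivAt_besselJOne {t : ℝ} (ht : 0 < t) :
    HasDerivAt besselJOne (besselJ t - besselJOne t / t) t := by
  refine (hasDerivAt_besselJOne' t).congr_deriv ?_
  rw [besselJOne_eq t, mul_div_cancel_left₀ _ ht.ne', sub_sub_cancel]

/-- A decreasing quantity dominating `t * J₀(t) ^ 2`. -/
noncomputable def besselEnergy (t : ℝ) : ℝ :=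
  t * (besselJ t ^ 2 + besselJOne t ^ 2) - besselJ t * besselJOne t + besselJ t ^ 2 / (2 * t)

lemma hasDerivAt_besselEnergy {t : ℝ} (ht : 0 < t) :
    HasDerivAt besselEnergy (-(besselJ t ^ 2 / (2 * t ^ 2))) t := by
  have h0 := hasDerivAt_besselJ t
  have h1 := hasDerivAt_besselJOne ht
  have := (((hasDerivAt_id t).fun_mul ((h0.fun_pow 2).fun_add (h1.fun_pow 2))).fun_sub
    (h0.fun_mul h1)).fun_add
    ((h0.fun_pow 2).fun_div ((hasDerivAt_id t).const_mul 2) (by simpa using ht.ne'))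
  refine this.congr_deriv ?_
  simp only [id]
  field_simp
  push_cast
  ring

lemma mul_besselJ_sq_le_energy {t : ℝ} (ht : 0 < t) : t * besselJ t ^ 2 ≤ besselEnergy t := by
  have : besselEnergy t = t * besselJ t ^ 2 + t * (besselJOne t - besselJ t / (2 * t)) ^ 2 +
      besselJ t ^ 2 / (4 * t) := by
    unfold besselEnergy
    field_simp
    ring
  rw [this]
  have h1 : 0 ≤ t * (besselJOne t - besselJ t / (2 * t)) ^ 2 := by positivity
  have h2 : 0 ≤ besselJ t ^ 2 / (4 * t) := by positivity
  linarith

lemma besselEnergy_antitoneOn : AntitoneOn besselEnergy (Set.Ioi 0) := by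
  refine antitoneOn_of_deriv_nonpos (convex_Ioi 0)
    (fun t ht => (hasDerivAt_besselEnergy ht).continuousAt.continuousWithinAt) ?_ ?_
  · intro t ht
    rw [interior_Ioi] at ht
    exact (hasDerivAt_besselEnergy ht).differentiableAt.differentiableWithinAt
  · intro t ht
    rw [interior_Ioi] at ht
    rw [(hasDerivAt_besselEnergy ht).deriv, neg_nonpos]
    positivity

lemma cos_add_le_of_nonneg (x : ℝ) {d : ℝ} (hd : 0 ≤ d) :
    Real.cos (x + d) - Real.cos x + d * Real.sin x ≤ d ^ 2 / 2 := by
  have hder : ∀ d, HasDerivAt (fun d : ℝ => d ^ 2 / 2 - Real.cos (x + d) - d * Real.sin x)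
      (d + Real.sin (x + d) - Real.sin x) d := fun d => by
    have := (((hasDerivAt_pow 2 d).div_const 2).fun_sub ((hasDerivAt_id d).const_add x).cos).fun_sub
      ((hasDerivAt_id d).mul_const (Real.sin x))
    refine this.congr_deriv ?_
    simp
  have hm : MonotoneOn (fun d : ℝ => d ^ 2 / 2 - Real.cos (x + d) - d * Real.sin x) (Set.Ici 0) := by
    refine monotoneOn_of_deriv_nonneg (convex_Ici 0) (by fun_prop) (by fun_prop) fun d hd => ?_
    rw [interior_Ici] at hd
    rw [(hder d).deriv]
    have h := Real.abs_sin_sub_sin_le x (x + d)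
    rw [sub_add_cancel_left, abs_neg d, abs_of_pos (show 0 < d from hd)] at h
    linarith [le_abs_self (Real.sin x - Real.sin (x + d))]
  have := hm Set.self_mem_Ici hd hd
  simp at this
  linarith

lemma cos_add_le (x d : ℝ) : Real.cos (x + d) - Real.cos x + d * Real.sin x ≤ d ^ 2 / 2 := by
  rcases le_total 0 d with hd | hd
  · exact cos_add_le_of_nonneg x hd
  · have := cos_add_le_of_nonneg (-x) (neg_nonneg.2 hd)
    rw [← neg_add, Real.cos_neg, Real.cos_neg, Real.sin_neg] at this
    linarith

/-- Second order Taylor bound for `J₀`, with derivative `-J₁`. -/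
lemma mul_besselJOne_le (t h : ℝ) :
    h * besselJOne t ≤ besselJ t - besselJ (t + h) + h ^ 2 / 4 := by
  have := angleAvg_mono (f := fun θ => Real.cos ((t + h) * Real.cos θ) +
      ((-1) * Real.cos (t * Real.cos θ) + h * (Real.cos θ * Real.sin (t * Real.cos θ))))
    (g := fun θ => (h ^ 2 / 2) * Real.cos θ ^ 2) (by fun_prop) (by fun_prop)
    (fun θ => by
      have := cos_add_le (t * Real.cos θ) (h * Real.cos θ)
      rw [show (t + h) * Real.cos θ = t * Real.cos θ + h * Real.cos θ by ring]
      linarith)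
  rw [angleAvg_add (by fun_prop) (by fun_prop), angleAvg_add (by fun_prop) (by fun_prop),
    angleAvg_const_mul, angleAvg_const_mul, angleAvg_const_mul, angleAvg_cos_sq] at this
  change besselJ (t + h) + (-1 * besselJ t + h * besselJOne t) ≤ _ at this
  linarith

noncomputable section

/-- Pass the value of a natural number to a function, forcing its evaluation. -/
def forceNat {α : Type} (n : ℕ) (f : ℕ → α) : α :=
  Nat.rec (f 0) (fun m _ => f (m + 1)) n

lemma forceNat_eq {α : Type} (n : ℕ) (f : ℕ → α) : forceNat n f = f n := by
  cases n <;> rfl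

/-- Backwards Horner evaluation of the power series of `J₀` at `z = p / q`; the partial sum
is `(P - Q) / D` and the three natural numbers are handed to `fin`. The loop carries `X = D + P`
instead of `D`, because the low bits of `D` vanish, which spoils the hashing of literals. -/
def hornerLoop {α : Type} (p q : ℕ) (fin : ℕ → ℕ → ℕ → α) (n : ℕ) : ℕ → ℕ → ℕ → α :=
  Nat.rec (fun P Q X => fin P Q (X - P)) (fun k ih P Q X =>
    forceNat (q * ((k + 1) * (k + 1)) * (X - P) + p * Q) fun P' => forceNat (p * P) fun Q' =>
      forceNat (q * ((k + 1) * (k + 1)) * (X - P) + P') fun X' => ih P' Q' X') n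

lemma hornerLoop_zero {α : Type} (p q : ℕ) (fin : ℕ → ℕ → ℕ → α) (P Q D : ℕ) :
    hornerLoop p q fin 0 P Q (D + P) = fin P Q D := by
  change fin P Q (D + P - P) = _
  rw [Nat.add_sub_cancel]

lemma hornerLoop_succ {α : Type} (p q : ℕ) (fin : ℕ → ℕ → ℕ → α) (n P Q D : ℕ) :
    hornerLoop p q fin (n + 1) P Q (D + P) = hornerLoop p q fin n
      (q * ((n + 1) * (n + 1)) * D + p * Q) (p * P)
      (q * ((n + 1) * (n + 1)) * D + (q * ((n + 1) * (n + 1)) * D + p * Q)) := by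
  change forceNat (q * ((n + 1) * (n + 1)) * (D + P - P) + p * Q) (fun P' => forceNat (p * P)
    fun Q' => forceNat (q * ((n + 1) * (n + 1)) * (D + P - P) + P') fun X' =>
      hornerLoop p q fin n P' Q' X') = _
  rw [forceNat_eq, forceNat_eq, forceNat_eq, Nat.add_sub_cancel]

lemma hornerLoop_spec {α : Type} {p q : ℕ} (hq : 0 < q) (fin : ℕ → ℕ → ℕ → α) (n : ℕ) :
    ∀ P Q D : ℕ, 0 < D → ∃ P' Q' D' : ℕ, hornerLoop p q fin n P Q (D + P) = fin P' Q' D' ∧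
      D' = q ^ n * n.factorial ^ 2 * D ∧
      ((P' : ℝ) - Q') / D' =
        ∑ k ∈ Finset.range n, (-1) ^ k * ((p : ℝ) / q) ^ k / (k.factorial : ℝ) ^ 2 +
          (-1) ^ n * ((p : ℝ) / q) ^ n / (n.factorial : ℝ) ^ 2 * (((P : ℝ) - Q) / D) := by
  have hq' : (q : ℝ) ≠ 0 := by positivity
  induction n with
  | zero => intro P Q D hD; exact ⟨P, Q, D, hornerLoop_zero .., by simp, by simp⟩
  | succ n ih =>
    intro P Q D hD
    rw [hornerLoop_succ]
    obtain ⟨P', Q', D', h1, h2, h3⟩ := ih (q * ((n + 1) * (n + 1)) * D + p * Q) (p * P)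
      (q * ((n + 1) * (n + 1)) * D) (by positivity)
    refine ⟨P', Q', D', h1, ?_, ?_⟩
    · rw [h2, Nat.factorial_succ]; ring
    · obtain ⟨z, hz⟩ : ∃ z : ℝ, (p : ℝ) = z * q := ⟨p / q, by field_simp⟩
      rw [h3, Finset.sum_range_succ, Nat.factorial_succ]
      push_cast
      rw [hz, mul_div_cancel_right₀ _ hq']
      generalize ∑ k ∈ Finset.range n, (-1) ^ k * z ^ k / (k.factorial : ℝ) ^ 2 = S
      have hD' : (D : ℝ) ≠ 0 := by positivity
      have hf : (n.factorial : ℝ) ≠ 0 := by positivity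
      field_simp
      ring

/-- The checks and output of the evaluation of `J₀`. -/
def besselFin (p q n P Q D : ℕ) : ℕ :=
  if 2 * 10 ^ 8 * p ^ (n + 1) ≤ D * q * (n + 1) ^ 2 ∧ 2 * p ≤ q * (n + 2) ^ 2 ∧ Q ≤ P + D
  then (P + D - Q) * 10 ^ 8 / D - 1 else 0

/-- A certified lower bound of `10 ^ 8 * (1 + J₀ (2 * √(p / q)))`. -/
def besselLower (p q : ℕ) : ℕ :=
  forceNat (3 * Nat.sqrt (p / q) + 14) fun n => hornerLoop p q (besselFin p q n) n 1 0 2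

lemma abs_besselJ_le_one (t : ℝ) : |besselJ t| ≤ 1 := by
  rw [abs_le]
  constructor
  · rw [← angleAvg_const (-1)]
    exact angleAvg_mono (by fun_prop) (by fun_prop) fun θ => Real.neg_one_le_cos _
  · rw [← angleAvg_const 1]
    exact angleAvg_mono (by fun_prop) (by fun_prop) fun θ => Real.cos_le_one _

/-- Truncation error of the power series of `J₀`. -/
lemma abs_besselJ_sub_sum_le (t : ℝ) (n : ℕ) (h : t ^ 2 / 4 ≤ ((n : ℝ) + 2) ^ 2 / 2) :
    |besselJ t - ∑ k ∈ Finset.range (n + 1), (-1) ^ k * (t ^ 2 / 4) ^ k / (k.factorial : ℝ) ^ 2| ≤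
      2 * ((t ^ 2 / 4) ^ (n + 1) / ((n + 1).factorial : ℝ) ^ 2) := by
  have hs := (hasSum_nat_add_iff' (n + 1)).2 (hasSum_besselJ t)
  set z := t ^ 2 / 4 with hz
  have hz0 : 0 ≤ z := by positivity
  set C := z ^ (n + 1) / ((n + 1).factorial : ℝ) ^ 2 with hC
  have hb : ∀ k : ℕ, z ^ (k + (n + 1)) / ((k + (n + 1)).factorial : ℝ) ^ 2 ≤ C * (1 / 2) ^ k := by
    intro k
    induction k with
    | zero => simp [hC]
    | succ k ih =>
      rw [show k + 1 + (n + 1) = (k + (n + 1)) + 1 by ring, Nat.factorial_succ, pow_succ z,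
        pow_succ (1 / 2 : ℝ), ← mul_assoc]
      push_cast
      rw [mul_pow, mul_comm ((_ : ℝ) ^ 2), mul_div_mul_comm]
      refine mul_le_mul ih ?_ (by positivity) (by positivity)
      rw [div_le_div_iff₀ (by positivity) (by positivity)]
      have : ((n : ℝ) + 2) ^ 2 ≤ ((k : ℝ) + (n + 1) + 1) ^ 2 := by
        have : (0 : ℝ) ≤ k := by positivity
        exact pow_le_pow_left₀ (by positivity) (by linarith) 2
      linarith
  have hg : HasSum (fun k : ℕ => C * (1 / 2 : ℝ) ^ k) (C * 2) :=
    hasSum_geometric_two.mul_left C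
  rw [mul_comm, ← hs.tsum_eq, ← hg.tsum_eq, ← Real.norm_eq_abs]
  refine tsum_of_norm_bounded hg.summable.hasSum fun k => ?_
  rw [Real.norm_eq_abs, abs_div, abs_mul, abs_pow, abs_neg, abs_one, one_pow, one_mul,
    abs_of_nonneg (pow_nonneg hz0 _), abs_of_nonneg (by positivity)]
  exact hb k

lemma abs_besselJ_sub_horner_le {p q n P Q D : ℕ} {x : ℝ} (hq : 0 < q)
    (hx : x ^ 2 / 4 = (p : ℝ) / q) (hD : D = q ^ n * n.factorial ^ 2)
    (hP : ((P : ℝ) - Q) / D =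
      ∑ k ∈ Finset.range (n + 1), (-1) ^ k * ((p : ℝ) / q) ^ k / (k.factorial : ℝ) ^ 2)
    (h1 : 2 * 10 ^ 8 * p ^ (n + 1) ≤ D * q * (n + 1) ^ 2) (h2 : 2 * p ≤ q * (n + 2) ^ 2) :
    |besselJ x - ((P : ℝ) - Q) / D| ≤ 1 / 10 ^ 8 := by
  have hq' : (0 : ℝ) < q := by positivity
  have h2' : 2 * (p : ℝ) ≤ q * (n + 2) ^ 2 := by exact_mod_cast h2
  have h1' : 2 * 10 ^ 8 * (p : ℝ) ^ (n + 1) ≤ q ^ n * n.factorial ^ 2 * q * (n + 1) ^ 2 := by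
    rw [hD] at h1
    exact_mod_cast h1
  have := abs_besselJ_sub_sum_le x n (by
    rw [hx, div_le_div_iff₀ hq' (by norm_num)]; linarith)
  rw [hx, ← hP] at this
  refine this.trans ?_
  have hf : (0 : ℝ) < n.factorial := by positivity
  rw [Nat.factorial_succ, div_pow]
  push_cast
  rw [div_div, ← mul_div_assoc, div_le_div_iff₀ (by positivity) (by norm_num)]
  calc _ = 2 * 10 ^ 8 * (p : ℝ) ^ (n + 1) := by ring
    _ ≤ _ := h1'
    _ = _ := by ring

lemma besselLower_le {p q : ℕ} {x : ℝ} (hq : 0 < q) (hx : x ^ 2 / 4 = (p : ℝ) / q) :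
    (besselLower p q : ℝ) / 10 ^ 8 - 1 ≤ besselJ x := by
  have hm1 := (abs_le.1 (abs_besselJ_le_one x)).1
  rw [besselLower, forceNat_eq]
  generalize 3 * Nat.sqrt (p / q) + 14 = n
  obtain ⟨P, Q, D, h1, h2, h3⟩ := hornerLoop_spec (p := p) hq (besselFin p q n) n 1 0 1 one_pos
  rw [show (2 : ℕ) = 1 + 1 from rfl, h1, besselFin]
  split_ifs with h
  · rw [mul_one] at h2
    have h4 := abs_besselJ_sub_horner_le hq hx h2
      (by rw [h3, Finset.sum_range_succ]; simp) h.1 h.2.1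
    have hD : 0 < D := by rw [h2]; positivity
    have hD' : (0 : ℝ) < D := by positivity
    have h5 : (((P + D - Q) * 10 ^ 8 / D : ℕ) : ℝ) ≤ (((P : ℝ) - Q) / D + 1) * 10 ^ 8 := by
      refine Nat.cast_div_le.trans (le_of_eq ?_)
      push_cast [Nat.cast_sub h.2.2]
      field_simp
      ring
    have h6 : (((P + D - Q) * 10 ^ 8 / D - 1 : ℕ) : ℝ) ≤
        max 0 ((((P : ℝ) - Q) / D + 1) * 10 ^ 8 - 1) := by
      rcases Nat.eq_zero_or_pos ((P + D - Q) * 10 ^ 8 / D) with h0 | h0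
      · rw [h0]; simp
      · rw [Nat.cast_sub h0]
        refine le_max_of_le_right ?_
        push_cast at h5 ⊢
        linarith
    rcases le_max_iff.1 h6 with h7 | h7
    · have : (((P + D - Q) * 10 ^ 8 / D - 1 : ℕ) : ℝ) / 10 ^ 8 ≤ 0 :=
        div_nonpos_of_nonpos_of_nonneg h7 (by norm_num)
      linarith
    · have h8 := (abs_le.1 h4).1
      have : (((P + D - Q) * 10 ^ 8 / D - 1 : ℕ) : ℝ) / 10 ^ 8 ≤
         ((((P : ℝ) - Q) / D + 1) * 10 ^ 8 - 1) / 10 ^ 8 := by gcongr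
      linarith
  · simp; linarith

end

lemma besselJ_eight_mem : besselJ 8 ∈ Set.Icc (0.1716507 : ℝ) 0.1716509 := by
  have h := abs_besselJ_sub_sum_le 8 16 (by norm_num)
  simp only [Finset.sum_range_succ, Finset.sum_range_zero, Nat.factorial] at h
  norm_num [abs_le] at h
  constructor <;> norm_num <;> linarith

lemma le_besselJ_eight_add : (0.1714160 : ℝ) ≤ besselJ (8 + 1 / 1000) := by
  have h := besselLower_le (p := 64016001) (q := 4000000) (x := 8 + 1 / 1000) (by norm_num)
    (by norm_num)
  have h2 : 117141600 ≤ besselLower 64016001 4000000 := by decide +kernel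
  have h3 : (117141600 : ℝ) ≤ besselLower 64016001 4000000 := by exact_mod_cast h2
  linarith

lemma le_besselJ_eight_sub : (0.194 : ℝ) ≤ besselJ (8 + -1 / 10) := by
  have h := besselLower_le (p := 6241) (q := 400) (x := 8 + -1 / 10) (by norm_num)
    (by norm_num)
  have h2 : 119400000 ≤ besselLower 6241 400 := by decide +kernel
  have h3 : (119400000 : ℝ) ≤ besselLower 6241 400 := by exact_mod_cast h2
  linarith

lemma besselEnergy_eight_le : besselEnergy 8 ≤ 0.64 := by
  obtain ⟨h1, h2⟩ := besselJ_eight_mem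
  have h3 := le_besselJ_eight_add
  have h4 := mul_besselJOne_le 8 (1 / 1000)
  have h5 := mul_besselJOne_le 8 (-1 / 10)
  have h6 := le_besselJ_eight_sub
  have h7 : besselJOne 8 ≤ 0.2352 := by linarith
  have h8 : 0.17 ≤ besselJOne 8 := by linarith
  unfold besselEnergy
  have h9 : besselJ 8 ^ 2 ≤ 0.1716509 ^ 2 := pow_le_pow_left₀ (by linarith) h2 2
  nlinarith [mul_nonneg (sub_nonneg.2 h7) (sub_nonneg.2 h8),
    mul_nonneg (sub_nonneg.2 h1) (show (0 : ℝ) ≤ besselJOne 8 by linarith)]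

lemma abs_besselJ_le {t : ℝ} (ht : 8 ≤ t) : |besselJ t| ≤ 0.8 / √t := by
  have h0 : 0 < t := by linarith
  have h1 := (mul_besselJ_sq_le_energy h0).trans
    ((besselEnergy_antitoneOn (by norm_num) h0 ht).trans besselEnergy_eight_le)
  rw [le_div_iff₀ (by positivity)]
  refine abs_le_of_sq_le_sq' ?_ (by norm_num) |>.2
  rw [mul_pow, sq_abs, Real.sq_sqrt h0.le]
  norm_num at h1 ⊢
  linarith

noncomputable section

/-- The radial profile of the dual certificate. -/
def clusterWeight (t : ℝ) : ℝ :=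
  0.1102 + 0.5419 * besselJ t + 0.3462 * besselJ (1.96 * t) +
    0.0528 * (2 * besselJ (√(91 / 64) * t) + besselJ (√(3 / 64) * t)) +
    0.0636 * (2 * besselJ (√(43 / 25) * t) + besselJ (√(3 / 25) * t))

/-- A certified lower bound of `10 ^ 12 * (clusterWeight (j / 32) + 1.1271)`. -/
def weightLower (j : ℕ) : ℕ :=
  5419 * besselLower (j * j) 4096 + 3462 * besselLower (2401 * (j * j)) 2560000 +
    1056 * besselLower (91 * (j * j)) 262144 + 528 * besselLower (3 * (j * j)) 262144 +
    1272 * besselLower (43 * (j * j)) 102400 + 636 * besselLower (3 * (j * j)) 102400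

lemma weightLower_le (j : ℕ) : (weightLower j : ℝ) / 10 ^ 12 - 1.1271 ≤ clusterWeight (j / 32) := by
  have h1 := besselLower_le (p := j * j) (q := 4096) (x := (j : ℝ) / 32) (by norm_num)
    (by push_cast; ring)
  have h2 := besselLower_le (p := 2401 * (j * j)) (q := 2560000) (x := 1.96 * ((j : ℝ) / 32))
    (by norm_num) (by push_cast; ring)
  have h3 := besselLower_le (p := 91 * (j * j)) (q := 262144) (x := √(91 / 64) * ((j : ℝ) / 32))
    (by norm_num) (by rw [mul_pow, Real.sq_sqrt (by norm_num)]; push_cast; ring)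
  have h4 := besselLower_le (p := 3 * (j * j)) (q := 262144) (x := √(3 / 64) * ((j : ℝ) / 32))
    (by norm_num) (by rw [mul_pow, Real.sq_sqrt (by norm_num)]; push_cast; ring)
  have h5 := besselLower_le (p := 43 * (j * j)) (q := 102400) (x := √(43 / 25) * ((j : ℝ) / 32))
    (by norm_num) (by rw [mul_pow, Real.sq_sqrt (by norm_num)]; push_cast; ring)
  have h6 := besselLower_le (p := 3 * (j * j)) (q := 102400) (x := √(3 / 25) * ((j : ℝ) / 32))
    (by norm_num) (by rw [mul_pow, Real.sq_sqrt (by norm_num)]; push_cast; ring)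
  unfold clusterWeight weightLower
  push_cast
  linarith

lemma clusterWeight_interp (a b s : ℝ) (h0 : 0 ≤ s) (h1 : s ≤ 1) :
    (1 - s) * clusterWeight a + s * clusterWeight b - 2.251 / 16 * (a - b) ^ 2 ≤
      clusterWeight ((1 - s) * a + s * b) := by
  have key : ∀ r : ℝ, (1 - s) * besselJ (r * a) + s * besselJ (r * b)
      - s * (1 - s) * (r ^ 2 * (a - b) ^ 2) / 4 ≤ besselJ (r * ((1 - s) * a + s * b)) := fun r => by
    have := besselJ_interp (r * a) (r * b) s h0 h1
    rw [show r * ((1 - s) * a + s * b) = (1 - s) * (r * a) + s * (r * b) by ring,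
      show r ^ 2 * (a - b) ^ 2 = (r * a - r * b) ^ 2 by ring]
    exact this
  have h2 := key 1
  have h3 := key 1.96
  have h4 := key √(91 / 64)
  have h5 := key √(3 / 64)
  have h6 := key √(43 / 25)
  have h7 := key √(3 / 25)
  rw [Real.sq_sqrt (by norm_num)] at h4 h5 h6 h7
  rw [one_mul, one_mul, one_mul] at h2
  have h8 : s * (1 - s) * (a - b) ^ 2 ≤ 1 / 4 * (a - b) ^ 2 := by
    gcongr
    nlinarith [sq_nonneg (s - 1 / 2)]
  have h9 : 0 ≤ s * (1 - s) * (a - b) ^ 2 := by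
    have := sub_nonneg.2 h1
    positivity
  unfold clusterWeight
  nlinarith [h8, h9]

/-- The condition that the weight is positive enough at the grid points `a / 32` and `b / 32`. -/
def gridStep (h w : ℕ) : Bool := Nat.ble (1127100000000 + 137390137 * (h * h)) w

lemma clusterWeight_nonneg_of_gridStep {a b : ℕ} (hab : a < b) (ha : gridStep (b - a) (weightLower a))
    (hb : gridStep (b - a) (weightLower b)) {t : ℝ} (h1 : (a : ℝ) / 32 ≤ t) (h2 : t ≤ (b : ℝ) / 32) :
    0 ≤ clusterWeight t := by
  have key : ∀ c : ℕ, gridStep (b - a) (weightLower c) →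
      2.251 / 16 * ((a : ℝ) / 32 - (b : ℝ) / 32) ^ 2 ≤ clusterWeight (c / 32) := by
    intro c hc
    have h := weightLower_le c
    rw [gridStep, Nat.ble_eq] at hc
    have hc' : (1127100000000 : ℝ) + 137390137 * (((b : ℝ) - a) * ((b : ℝ) - a)) ≤ weightLower c := by
      rw [← Nat.cast_sub hab.le]
      exact_mod_cast hc
    nlinarith [mul_self_nonneg ((b : ℝ) - a)]
  have hab' : (0 : ℝ) < (b : ℝ) / 32 - (a : ℝ) / 32 := by
    have : (a : ℝ) < b := by exact_mod_cast hab
    linarith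
  set s : ℝ := (t - (a : ℝ) / 32) / ((b : ℝ) / 32 - (a : ℝ) / 32) with hs
  have hs0 : 0 ≤ s := div_nonneg (by linarith) hab'.le
  have hs1 : s ≤ 1 := by rw [hs, div_le_one hab']; linarith
  have hst : (1 - s) * ((a : ℝ) / 32) + s * ((b : ℝ) / 32) = t := by
    have : s * ((b : ℝ) / 32 - (a : ℝ) / 32) = t - (a : ℝ) / 32 := by
      rw [hs, div_mul_cancel₀ _ hab'.ne']
    linarith
  have := clusterWeight_interp ((a : ℝ) / 32) ((b : ℝ) / 32) s hs0 hs1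
  rw [hst] at this
  have h3 := mul_le_mul_of_nonneg_left (key a ha) (sub_nonneg.2 hs1)
  have h4 := mul_le_mul_of_nonneg_left (key b hb) hs0
  linarith

/-- Check all steps of a grid starting at `a`. -/
def gridCheck (a : ℕ) (l : List ℕ) : Bool :=
  List.rec (fun _ => true) (fun b _ ih a => Nat.blt a b && gridStep (b - a) (weightLower a) &&
    gridStep (b - a) (weightLower b) && ih b) l a

lemma gridCheck_cons (a b : ℕ) (l : List ℕ) : gridCheck a (b :: l) =
    (Nat.blt a b && gridStep (b - a) (weightLower a) && gridStep (b - a) (weightLower b) &&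
      gridCheck b l) := rfl

lemma clusterWeight_nonneg_of_gridCheck (l : List ℕ) :
    ∀ a : ℕ, gridCheck a l → ∀ t : ℝ, (a : ℝ) / 32 ≤ t →
      t ≤ (l.getLastD a : ℝ) / 32 → t ≠ (a : ℝ) / 32 → 0 ≤ clusterWeight t := by
  induction l with
  | nil =>
    intro a _ t h1 h2 h3
    exact absurd (le_antisymm h2 h1) h3
  | cons b l ih =>
    intro a h t h1 h2 _
    rw [gridCheck_cons] at h
    simp only [Bool.and_eq_true, Nat.blt_eq] at h
    obtain ⟨⟨⟨hab, ha⟩, hb⟩, hl⟩ := h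
    rcases le_or_gt t ((b : ℝ) / 32) with ht | ht
    · exact clusterWeight_nonneg_of_gridStep hab ha hb h1 ht
    · refine ih b hl t ht.le ?_ ht.ne'
      rwa [List.getLastD_cons] at h2

/-- The grid (in units of `1 / 32`) on which the certificate is evaluated. -/
def certGrid : List ℕ :=
  [47, 71, 83, 91, 99, 107, 117, 125, 131, 135, 137, 139, 141, 143, 145, 149, 155, 167, 191,
   235, 259, 271, 277, 281, 287, 293, 301, 315, 331, 343, 351, 355, 357, 359, 361, 363, 365,
   369, 375, 387, 409, 443, 467, 483, 499, 515, 531, 543, 551, 557, 563, 569, 577, 591, 617,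
   653, 677, 693, 709, 725, 743, 761, 779, 801, 833, 863, 883, 899, 915, 933, 953, 973, 993,
   1019, 1055, 1081, 1101, 1121, 1141, 1165, 1189, 1217, 1255, 1281, 1297, 1309, 1321, 1335,
   1355, 1379, 1405, 1435, 1463, 1481, 1493, 1503, 1513, 1523, 1537, 1557, 1581, 1605, 1629,
   1659, 1685, 1707, 1729, 1751, 1775, 1801, 1829, 1865, 1893, 1911, 1927, 1943, 1963, 1989,
   2019, 2051, 2079, 2099, 2113, 2125, 2137, 2153, 2175, 2203, 2233, 2263, 2289, 2309, 2327,
   2345, 2365, 2391, 2419, 2449, 2479, 2503, 2519]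

lemma gridCheck_certGrid : gridCheck 0 certGrid = true := by decide +kernel

end

lemma neg_le_besselJ {x X q : ℝ} (hX : 8 ≤ X) (hx : X ≤ x) (hq : 0 ≤ q) (h : 0.64 ≤ q ^ 2 * X) :
    -q ≤ besselJ x := by
  have h1 := abs_besselJ_le (hX.trans hx)
  have h2 : 0.8 / √x ≤ q := by
    rw [div_le_iff₀ (Real.sqrt_pos.2 (by linarith))]
    refine le_of_sq_le_sq ?_ (by positivity)
    rw [mul_pow, Real.sq_sqrt (by linarith)]
    have := mul_le_mul_of_nonneg_left hx (sq_nonneg q)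
    norm_num at h ⊢
    linarith
  linarith [(abs_le.1 h1).1]

lemma neg_le_besselJ_sqrt_mul {c r t q : ℝ} (hrc : r ^ 2 ≤ c) (ht : 78.7 ≤ t)
    (hX : 8 ≤ r * 78.7) (hq : 0 ≤ q) (h : 0.64 ≤ q ^ 2 * (r * 78.7)) :
    -q ≤ besselJ (√c * t) :=
  neg_le_besselJ hX (mul_le_mul (Real.le_sqrt_of_sq_le hrc) ht (by norm_num) (Real.sqrt_nonneg _))
    hq h

lemma clusterWeight_nonneg {t : ℝ} (ht : 0 ≤ t) : 0 ≤ clusterWeight t := by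
  rcases eq_or_ne t 0 with rfl | h0
  · simp [clusterWeight, besselJ_zero]
    norm_num
  rcases le_or_gt t (2519 / 32) with h1 | h1
  · exact clusterWeight_nonneg_of_gridCheck certGrid 0 gridCheck_certGrid t (by simpa using ht)
      (by rw [show certGrid.getLastD 0 = 2519 from rfl]; exact_mod_cast h1) (by simpa using h0)
  · have ht : 78.7 ≤ t := by linarith
    have h2 : -0.0902 ≤ besselJ t := neg_le_besselJ (X := 78.7) (by norm_num) ht (by norm_num) (by norm_num)
    have h3 : -0.06445 ≤ besselJ (1.96 * t) :=
      neg_le_besselJ (X := 1.96 * 78.7) (by norm_num) (by linarith) (by norm_num) (by norm_num)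
    have h4 : -0.0827 ≤ besselJ (√(91 / 64) * t) :=
      neg_le_besselJ_sqrt_mul (r := 1.192) (by norm_num) ht (by norm_num) (by norm_num)
        (by norm_num)
    have h5 : -0.1939 ≤ besselJ (√(3 / 64) * t) :=
      neg_le_besselJ_sqrt_mul (r := 0.2165) (by norm_num) ht (by norm_num)
        (by norm_num) (by norm_num)
    have h6 : -0.0788 ≤ besselJ (√(43 / 25) * t) :=
      neg_le_besselJ_sqrt_mul (r := 1.311) (by norm_num) ht (by norm_num)
        (by norm_num) (by norm_num)
    have h7 : -0.15325 ≤ besselJ (√(3 / 25) * t) :=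
      neg_le_besselJ_sqrt_mul (r := 0.3464) (by norm_num) ht (by norm_num)
        (by norm_num) (by norm_num)
    unfold clusterWeight
    linarith

noncomputable section

/-- The Haar probability measure on the torus. -/
abbrev torusHaar (T : ℝ) [Fact (0 < T)] : Measure (AddCircle T × AddCircle T) :=
  (AddCircle.haarAddCircle (T := T)).prod (AddCircle.haarAddCircle (T := T))

/-- The characters of the torus. -/
def torusChar (T : ℝ) (k : Fin 2 → ℤ) (x : AddCircle T × AddCircle T) : ℂ :=
  fourier (k 0) x.1 * fourier (k 1) x.2

section

variable {T : ℝ}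

lemma continuous_torusChar (k : Fin 2 → ℤ) : Continuous (torusChar T k) := by
  unfold torusChar
  fun_prop

lemma norm_torusChar (k : Fin 2 → ℤ) (x : AddCircle T × AddCircle T) : ‖torusChar T k x‖ = 1 := by
  rw [torusChar, norm_mul, fourier_apply, fourier_apply, Circle.norm_coe, Circle.norm_coe, mul_one]

lemma torusChar_add (k : Fin 2 → ℤ) (x y : AddCircle T × AddCircle T) :
    torusChar T k (x + y) = torusChar T k x * torusChar T k y := by
  simp [torusChar, fourier_apply, smul_add, AddCircle.toCircle_add]
  ring

lemma torusChar_neg (k : Fin 2 → ℤ) (x : AddCircle T × AddCircle T) :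
    torusChar T (-k) x = (starRingEnd ℂ) (torusChar T k x) := by
  simp [torusChar]

variable [hT : Fact (0 < T)]

/-- The rescaling of the unit torus onto the torus of side `T`. -/
def torusRescale (T : ℝ) [hT : Fact (0 < T)] :
    UnitAddTorus (Fin 2) →+ AddCircle T × AddCircle T where
  toFun u := (AddCircle.equivAddCircle 1 T one_ne_zero hT.out.ne' (u 0),
    AddCircle.equivAddCircle 1 T one_ne_zero hT.out.ne' (u 1))
  map_zero' := by simp
  map_add' := by simp

lemma continuous_torusRescale : Continuous (torusRescale T) := by
  have := (AddCircle.homeomorphAddCircle 1 T one_ne_zero hT.out.ne').continuous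
  exact (this.comp (continuous_apply 0)).prodMk (this.comp (continuous_apply 1))

lemma surjective_torusRescale : Function.Surjective (torusRescale T) := by
  rintro ⟨a, b⟩
  refine ⟨![(AddCircle.equivAddCircle 1 T one_ne_zero hT.out.ne').symm a,
    (AddCircle.equivAddCircle 1 T one_ne_zero hT.out.ne').symm b], ?_⟩
  simp [torusRescale]

lemma fourier_equivAddCircle (n : ℤ) (u : UnitAddCircle) :
    fourier n (AddCircle.equivAddCircle 1 T one_ne_zero hT.out.ne' u) = fourier n u := by
  induction u using QuotientAddGroup.induction_on with
  | H x =>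
    have := AddCircle.equivAddCircle_apply_mk (1 : ℝ) T one_ne_zero hT.out.ne' x
    erw [this]
    have h0 := hT.out.ne'
    erw [fourier_coe_apply, fourier_coe_apply]
    congr 1
    push_cast
    have : (T : ℂ) ≠ 0 := by exact_mod_cast h0
    field_simp

lemma torusChar_torusRescale (k : Fin 2 → ℤ) (u : UnitAddTorus (Fin 2)) :
    torusChar T k (torusRescale T u) = UnitAddTorus.mFourier k u := by
  change _ = ∏ i, fourier (k i) (u i)
  rw [Fin.prod_univ_two]
  exact congrArg₂ _ (fourier_equivAddCircle _ _) (fourier_equivAddCircle _ _)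

attribute [local instance] instMeasureSpaceUnitAddCircle

local instance : Measure.IsAddHaarMeasure (volume : Measure UnitAddCircle) :=
  inferInstanceAs (Measure.IsAddHaarMeasure AddCircle.haarAddCircle)

local instance : IsProbabilityMeasure (volume : Measure UnitAddCircle) :=
  inferInstanceAs (IsProbabilityMeasure AddCircle.haarAddCircle)

lemma measurePreserving_torusRescale :
    MeasurePreserving (torusRescale T) (volume : Measure (UnitAddTorus (Fin 2))) (torusHaar T) := by
  refine AddMonoidHom.measurePreserving continuous_torusRescale surjective_torusRescale ?_
  simp

lemma integral_torusRescale {F : AddCircle T × AddCircle T → ℂ}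
    (hF : AEStronglyMeasurable F (torusHaar T)) :
    ∫ u : UnitAddTorus (Fin 2), F (torusRescale T u) = ∫ y, F y ∂torusHaar T := by
  have hmp := measurePreserving_torusRescale (T := T)
  rw [← hmp.map_eq] at hF ⊢
  rw [integral_map hmp.measurable.aemeasurable hF]

lemma hasSum_torusChar_parseval {f g : AddCircle T × AddCircle T → ℂ}
    (hf : MemLp f 2 (torusHaar T)) (hg : MemLp g 2 (torusHaar T)) :
    HasSum (fun k : Fin 2 → ℤ => (starRingEnd ℂ) (∫ y, torusChar T (-k) y * f y ∂torusHaar T) *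
      ∫ y, torusChar T (-k) y * g y ∂torusHaar T)
      (∫ y, (starRingEnd ℂ) (f y) * g y ∂torusHaar T) := by
  have hmp := measurePreserving_torusRescale (T := T)
  have hf' := hf.comp_measurePreserving hmp
  have hg' := hg.comp_measurePreserving hmp
  have key : ∀ {h : AddCircle T × AddCircle T → ℂ} (hh : MemLp h 2 (torusHaar T)) (k : Fin 2 → ℤ),
      UnitAddTorus.mFourierCoeff (hh.comp_measurePreserving hmp).toLp k =
        ∫ y, torusChar T (-k) y * h y ∂torusHaar T := by
    intro h hh k
    unfold UnitAddTorus.mFourierCoeff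
    rw [← integral_torusRescale (F := fun y => torusChar T (-k) y * h y) ((continuous_torusChar _).aestronglyMeasurable.mul hh.1)]
    refine integral_congr_ae ?_
    filter_upwards [(hh.comp_measurePreserving hmp).coeFn_toLp] with u hu
    rw [hu, torusChar_torusRescale, smul_eq_mul]
    rfl
  have := UnitAddTorus.hasSum_prod_mFourierCoeff hf'.toLp hg'.toLp
  convert this using 1
  · ext k
    rw [key hf, key hg]
  · rw [← integral_torusRescale (F := fun y => (starRingEnd ℂ) (f y) * g y)
      ((Complex.continuous_conj.comp_aestronglyMeasurable hf.1).mul hg.1)]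
    refine integral_congr_ae ?_
    filter_upwards [hf'.coeFn_toLp, hg'.coeFn_toLp] with u hu hv
    rw [hu, hv]
    rfl

end

end

noncomputable section

/-- A measurable function on the torus with values in `[0, 1]`. -/
structure IsDens {T : ℝ} (p : AddCircle T × AddCircle T → ℝ) : Prop where
  measurable : Measurable p
  nonneg : ∀ x, 0 ≤ p x
  le_one : ∀ x, p x ≤ 1

lemma isDens_indicator {T : ℝ} {A : Set (AddCircle T × AddCircle T)} (hA : MeasurableSet A) :
    IsDens (A.indicator 1) where
  measurable := measurable_one.indicator hA
  nonneg := Set.indicator_nonneg fun _ _ => zero_le_one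
  le_one x := Set.indicator_le' (g := 1) (fun _ _ => le_rfl) (fun _ _ => zero_le_one) x

lemma IsDens.mul_comp_add {T : ℝ} {p q : AddCircle T × AddCircle T → ℝ} (hp : IsDens p) (hq : IsDens q)
    (x : AddCircle T × AddCircle T) : IsDens fun y => p y * q (y + x) where
  measurable := hp.measurable.mul (hq.measurable.comp (measurable_add_const x))
  nonneg _ := mul_nonneg (hp.nonneg _) (hq.nonneg _)
  le_one _ := mul_le_one₀ (hp.le_one _) (hq.nonneg _) (hq.le_one _)

lemma torusChar_zero {T : ℝ} (k : Fin 2 → ℤ) : torusChar T k 0 = 1 := by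
  simp [torusChar, fourier_apply]

/-- The point of the torus with polar coordinates `(r, θ)`. -/
def torusPolar (T r θ : ℝ) : AddCircle T × AddCircle T :=
  (((r * Real.cos θ : ℝ) : AddCircle T), ((r * Real.sin θ : ℝ) : AddCircle T))

lemma continuous_torusPolar {T : ℝ} (r : ℝ) : Continuous (torusPolar T r) := by
  unfold torusPolar
  exact ((AddCircle.continuous_mk' T).comp (by fun_prop)).prodMk
    ((AddCircle.continuous_mk' T).comp (by fun_prop))

variable {T : ℝ} [hT : Fact (0 < T)]

lemma IsDens.memLp {p : AddCircle T × AddCircle T → ℝ} (hp : IsDens p) (q : ℝ≥0∞) :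
    MemLp p q (torusHaar T) :=
  MemLp.of_bound hp.measurable.aestronglyMeasurable 1 (ae_of_all _ fun x => by
    rw [Real.norm_eq_abs, abs_of_nonneg (hp.nonneg x)]; exact hp.le_one x)

lemma IsDens.integrable {p : AddCircle T × AddCircle T → ℝ} (hp : IsDens p) :
    Integrable p (torusHaar T) := memLp_one_iff_integrable.1 (hp.memLp 1)

/-- The autocorrelation of a function on the torus. -/
def corr (p : AddCircle T × AddCircle T → ℝ) (x : AddCircle T × AddCircle T) : ℝ :=
  ∫ y, p y * p (y + x) ∂torusHaar T

/-- The squared modulus of a Fourier coefficient. -/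
def coefSq (p : AddCircle T × AddCircle T → ℝ) (k : Fin 2 → ℤ) : ℝ :=
  (∫ y, p y * (torusChar T k y).re ∂torusHaar T) ^ 2 +
    (∫ y, p y * (torusChar T k y).im ∂torusHaar T) ^ 2

lemma coefSq_nonneg (p : AddCircle T × AddCircle T → ℝ) (k : Fin 2 → ℤ) : 0 ≤ coefSq p k := by
  unfold coefSq
  positivity

lemma coefSq_zero (p : AddCircle T × AddCircle T → ℝ) :
    coefSq p 0 = (∫ y, p y ∂torusHaar T) ^ 2 := by
  simp [coefSq, torusChar]

lemma integral_torusChar_neg_mul {p : AddCircle T × AddCircle T → ℝ} (hp : IsDens p)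
    (k : Fin 2 → ℤ) :
    ∫ y, torusChar T (-k) y * (p y : ℂ) ∂torusHaar T =
      (∫ y, p y * (torusChar T k y).re ∂torusHaar T : ℝ) -
        (∫ y, p y * (torusChar T k y).im ∂torusHaar T : ℝ) * Complex.I := by
  have hint : Integrable (fun y => torusChar T (-k) y * (p y : ℂ)) (torusHaar T) := by
    refine hp.integrable.ofReal.bdd_mul (c := 1)
      (continuous_torusChar _).aestronglyMeasurable (ae_of_all _ fun x => (norm_torusChar _ _).le)
  apply Complex.ext
  · have := integral_re hint
    rw [RCLike.re_eq_complex_re] at this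
    rw [← this]
    simp [torusChar_neg, mul_comm]
  · have := integral_im hint
    rw [RCLike.im_eq_complex_im] at this
    rw [← this]
    simp [torusChar_neg, mul_comm, integral_neg]

lemma hasSum_corr {p : AddCircle T × AddCircle T → ℝ} (hp : IsDens p)
    (x : AddCircle T × AddCircle T) :
    HasSum (fun k => coefSq p k * (torusChar T k x).re) (corr p x) := by
  have hmp : MeasurePreserving (fun y => y + x) (torusHaar T) (torusHaar T) :=
    measurePreserving_add_right _ x
  have hf : MemLp (fun y => (p y : ℂ)) 2 (torusHaar T) := (hp.memLp 2).ofReal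
  have hg := hf.comp_measurePreserving hmp
  have h := Complex.hasSum_re (hasSum_torusChar_parseval hf hg)
  convert h using 1
  · ext k
    have h1 : ∫ y, torusChar T (-k) y * ((fun y => (p y : ℂ)) ∘ fun y => y + x) y ∂torusHaar T =
        torusChar T k x * ∫ y, torusChar T (-k) y * (p y : ℂ) ∂torusHaar T := by
      rw [← integral_const_mul,
        ← integral_add_right_eq_self (fun y => torusChar T k x * (torusChar T (-k) y * (p y : ℂ))) x]
      refine integral_congr_ae (ae_of_all _ fun y => ?_)
      simp only [Function.comp]
      have h2 : torusChar T k x * torusChar T (-k) x = 1 := by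
        rw [torusChar_neg k x, Complex.mul_conj, Complex.normSq_eq_norm_sq, norm_torusChar]
        simp
      rw [torusChar_add]
      linear_combination (-torusChar T (-k) y * (p (y + x) : ℂ)) * h2
    rw [h1, integral_torusChar_neg_mul hp]
    simp [coefSq]
    ring
  · have h2 : (fun y => (starRingEnd ℂ) (p y : ℂ) * ((fun y => (p y : ℂ)) ∘ fun y => y + x) y) =
        fun y => ((p y * p (y + x) : ℝ) : ℂ) := by
      ext y
      simp
    rw [h2, integral_complex_ofReal, Complex.ofReal_re]
    rfl

lemma summable_coefSq {p : AddCircle T × AddCircle T → ℝ} (hp : IsDens p) :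
    Summable (coefSq p) := by
  have := (hasSum_corr hp 0).summable
  simpa [torusChar_zero] using this

lemma tsum_coefSq_le_one {p : AddCircle T × AddCircle T → ℝ} (hp : IsDens p) :
    ∑' k, coefSq p k ≤ 1 := by
  have := (hasSum_corr hp 0).tsum_eq
  simp only [torusChar_zero, Complex.one_re, mul_one] at this
  rw [this]
  have h := hp.mul_comp_add hp 0
  refine (integral_mono h.integrable (integrable_const 1) h.le_one).trans ?_
  simp

lemma abs_coefSq_mul_re_le (p : AddCircle T × AddCircle T → ℝ) (k : Fin 2 → ℤ)
    (x : AddCircle T × AddCircle T) : ‖coefSq p k * (torusChar T k x).re‖ ≤ coefSq p k := by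
  rw [norm_mul, Real.norm_of_nonneg (coefSq_nonneg p k)]
  refine mul_le_of_le_one_right (coefSq_nonneg p k) ?_
  rw [← norm_torusChar k x]
  exact Complex.abs_re_le_norm _

lemma continuous_corr {p : AddCircle T × AddCircle T → ℝ} (hp : IsDens p) :
    Continuous (corr p) := by
  have h : corr p = fun x => ∑' k, coefSq p k * (torusChar T k x).re :=
    funext fun x => (hasSum_corr hp x).tsum_eq.symm
  rw [h]
  refine continuous_tsum (fun k => ?_) (summable_coefSq hp) (abs_coefSq_mul_re_le p)
  exact continuous_const.mul (Complex.continuous_re.comp (continuous_torusChar k))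

lemma corr_nonneg {p : AddCircle T × AddCircle T → ℝ} (hp : IsDens p)
    (x : AddCircle T × AddCircle T) : 0 ≤ corr p x :=
  integral_nonneg fun _ => mul_nonneg (hp.nonneg _) (hp.nonneg _)

/-- The radialized autocorrelation of a function on the torus. -/
def radialCorr (p : AddCircle T × AddCircle T → ℝ) (r : ℝ) : ℝ :=
  angleAvg fun θ => corr p (torusPolar T r θ)

/-- The norm of the frequency of a character. -/
def charFreq (T : ℝ) (k : Fin 2 → ℤ) : ℝ := 2 * Real.pi / T * √((k 0 : ℝ) ^ 2 + (k 1 : ℝ) ^ 2)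

lemma angleAvg_torusChar (k : Fin 2 → ℤ) {r : ℝ} (hr : 0 ≤ r) :
    angleAvg (fun θ => (torusChar T k (torusPolar T r θ)).re) = besselJ (r * charFreq T k) := by
  have h0 := hT.out
  have h : (fun θ => (torusChar T k (torusPolar T r θ)).re) = fun θ =>
      Real.cos (2 * Real.pi / T * r * k 0 * Real.cos θ + 2 * Real.pi / T * r * k 1 * Real.sin θ) := by
    ext θ
    rw [torusChar, torusPolar, fourier_coe_apply, fourier_coe_apply, ← Complex.exp_add,
      ← Complex.exp_ofReal_mul_I_re (2 * Real.pi / T * r * k 0 * Real.cos θ + _)]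
    congr 2
    push_cast
    have : (T : ℂ) ≠ 0 := by exact_mod_cast h0.ne'
    field_simp
  rw [h, angleAvg_cos_linear]
  congr 1
  rw [show (2 * Real.pi / T * r * k 0) ^ 2 + (2 * Real.pi / T * r * k 1) ^ 2 =
    (2 * Real.pi / T * r) ^ 2 * ((k 0 : ℝ) ^ 2 + (k 1 : ℝ) ^ 2) by ring,
    Real.sqrt_mul (sq_nonneg _), Real.sqrt_sq (by positivity), charFreq]
  ring

lemma hasSum_radialCorr {p : AddCircle T × AddCircle T → ℝ} (hp : IsDens p) {r : ℝ} (hr : 0 ≤ r) :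
    HasSum (fun k => coefSq p k * besselJ (r * charFreq T k)) (radialCorr p r) := by
  have h := intervalIntegral.hasSum_integral_of_dominated_convergence (μ := volume)
    (a := 0) (b := 2 * Real.pi)
    (F := fun k θ => coefSq p k * (torusChar T k (torusPolar T r θ)).re)
    (f := fun θ => corr p (torusPolar T r θ)) (fun k _ => coefSq p k)
    (fun k => Continuous.aestronglyMeasurable (continuous_const.mul
      (Complex.continuous_re.comp ((continuous_torusChar k).comp (continuous_torusPolar r)))))
    (fun k => ae_of_all _ fun θ _ => abs_coefSq_mul_re_le p k _)
    (ae_of_all _ fun θ _ => summable_coefSq hp)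
    (continuous_const.intervalIntegrable _ _)
    (ae_of_all _ fun θ _ => hasSum_corr hp _)
  have h2 := h.mul_left (1 / (2 * Real.pi))
  have e : (fun k => coefSq p k * besselJ (r * charFreq T k)) = fun k => 1 / (2 * Real.pi) *
      ∫ θ in (0:ℝ)..(2 * Real.pi), coefSq p k * (torusChar T k (torusPolar T r θ)).re := by
    ext k
    rw [← angleAvg_torusChar k hr, ← angleAvg_const_mul]
    rfl
  rw [e]
  exact h2

lemma torusHaar_real_eq_density {A : Set (AddCircle T × AddCircle T)} :
    density T A = (torusHaar T).real A := by
  have h0 := hT.out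
  have hv : (volume : Measure (AddCircle T × AddCircle T)) =
      (ENNReal.ofReal T * ENNReal.ofReal T) • torusHaar T := by
    rw [Measure.volume_eq_prod, AddCircle.volume_eq_smul_haarAddCircle, Measure.prod_smul_left,
      Measure.prod_smul_right, smul_smul]
  rw [density, torusVolume, dif_pos h0, hv, Measure.smul_apply, smul_eq_mul, ENNReal.toReal_mul,
    ENNReal.toReal_mul, ENNReal.toReal_ofReal h0.le, Measure.real]
  field_simp

lemma corr_indicator {A : Set (AddCircle T × AddCircle T)} (hA : MeasurableSet A)
    (x : AddCircle T × AddCircle T) : corr (A.indicator 1) x = autocorr T A x := by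
  rw [autocorr, torusHaar_real_eq_density,
    ← integral_indicator_one (hA.inter (measurable_add_const x hA)), corr]
  congr 1
  ext y
  by_cases h1 : y ∈ A <;> by_cases h2 : y + x ∈ A <;> simp [h1, h2]

lemma radialCorr_indicator {A : Set (AddCircle T × AddCircle T)} (hA : MeasurableSet A) (r : ℝ) :
    radialCorr (A.indicator 1) r = paircorr T A r := by
  unfold radialCorr paircorr angleAvg
  simp only [corr_indicator hA]
  rfl

lemma integral_indicator_eq_density {A : Set (AddCircle T × AddCircle T)} (hA : MeasurableSet A) :
    ∫ y, A.indicator 1 y ∂torusHaar T = density T A := by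
  rw [integral_indicator_one hA, torusHaar_real_eq_density]

end

section

lemma angleAvg_eq_zero {g : ℝ → ℝ} (hg : Continuous g) (h0 : ∀ θ, 0 ≤ g θ)
    (hper : Function.Periodic g (2 * Real.pi)) (h : angleAvg g = 0) (θ : ℝ) : g θ = 0 := by
  by_contra hne
  obtain ⟨y, hy, hyeq⟩ := hper.exists_mem_Ico₀ Real.two_pi_pos θ
  have hpos : 0 < ∫ θ in (0:ℝ)..(2 * Real.pi), g θ :=
    intervalIntegral.integral_pos Real.two_pi_pos hg.continuousOn (fun x _ => h0 x)
      ⟨y, ⟨hy.1, hy.2.le⟩, (h0 y).lt_of_ne' (by rwa [← hyeq])⟩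
  have := Real.pi_pos
  unfold angleAvg at h
  exact (mul_pos (by positivity) hpos).ne' h

lemma periodic_torusPolar (T r : ℝ) : Function.Periodic (torusPolar T r) (2 * Real.pi) := fun θ => by
  simp [torusPolar]

lemma torusPolar_sub {T r r' t θ θ' ψ : ℝ}
    (hc : r * Real.cos θ - r' * Real.cos θ' = t * Real.cos ψ)
    (hs : r * Real.sin θ - r' * Real.sin θ' = t * Real.sin ψ) :
    torusPolar T r θ - torusPolar T r' θ' = torusPolar T t ψ := by
  simp only [torusPolar, Prod.mk_sub_mk, ← AddCircle.coe_sub, hc, hs]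

variable {T : ℝ} [hT : Fact (0 < T)]

lemma corr_torusPolar_eq_zero {p : AddCircle T × AddCircle T → ℝ} (hp : IsDens p) {r : ℝ}
    (h : radialCorr p r = 0) (θ : ℝ) : corr p (torusPolar T r θ) = 0 :=
  angleAvg_eq_zero (g := fun θ => corr p (torusPolar T r θ))
    ((continuous_corr hp).comp (continuous_torusPolar r))
    (fun _ => corr_nonneg hp _) (fun θ => by simp only [periodic_torusPolar T r θ]) h θ

lemma ae_mul_eq_zero_of_corr {p : AddCircle T × AddCircle T → ℝ} (hp : IsDens p)
    {u v w : AddCircle T × AddCircle T} (h : corr p w = 0) (hw : v - u = w) :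
    ∀ᵐ y ∂torusHaar T, p (y + u) * p (y + v) = 0 := by
  have h1 : ∫ y, p (y + u) * p (y + v) ∂torusHaar T = 0 := by
    rw [← h, corr, ← integral_add_right_eq_self (fun y => p y * p (y + w)) u]
    congr 1
    ext y
    rw [← hw, add_assoc, add_sub_cancel]
  have h2 := (integral_eq_zero_iff_of_nonneg (fun y => mul_nonneg (hp.nonneg _) (hp.nonneg _)) (by
    have h3 : IsDens fun y => p (y + u) * p (y + v) :=
      { measurable := (hp.measurable.comp (measurable_add_const u)).mul
          (hp.measurable.comp (measurable_add_const v))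
        nonneg := fun _ => mul_nonneg (hp.nonneg _) (hp.nonneg _)
        le_one := fun _ => mul_le_one₀ (hp.le_one _) (hp.nonneg _) (hp.le_one _) }
    exact h3.integrable)).1 h1
  exact h2

lemma corr_triangle {D : Set (AddCircle T × AddCircle T)} (hD : MeasurableSet D)
    {u v w : AddCircle T × AddCircle T} {x y z : AddCircle T × AddCircle T}
    (hx : corr (D.indicator 1) x = 0) (hux : u - v = x)
    (hy : corr (D.indicator 1) y = 0) (huy : u - w = y)
    (hz : corr (D.indicator 1) z = 0) (huz : v - w = z) :
    corr (D.indicator 1) u + corr (D.indicator 1) v + corr (D.indicator 1) w ≤ density T D := by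
  have hp := isDens_indicator hD
  rw [← integral_indicator_eq_density hD]
  unfold corr
  have hi := fun u => (hp.mul_comp_add hp u).integrable
  rw [← integral_add (hi u) (hi v), ← integral_add (by exact (hi u).add (hi v)) (hi w)]
  refine integral_mono_ae (by exact ((hi u).add (hi v)).add (hi w)) hp.integrable ?_
  filter_upwards [ae_mul_eq_zero_of_corr hp hx hux, ae_mul_eq_zero_of_corr hp hy huy,
    ae_mul_eq_zero_of_corr hp hz huz] with t h1 h2 h3
  classical
  simp only [Set.indicator_apply, Pi.one_apply] at h1 h2 h3 ⊢
  split_ifs at h1 h2 h3 ⊢ <;> simp_all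

lemma angleAvg_corr_shift {p : AddCircle T × AddCircle T → ℝ} (r φ : ℝ) :
    angleAvg (fun θ => corr p (torusPolar T r (θ + φ))) = radialCorr p r :=
  angleAvg_shift (g := fun θ => corr p (torusPolar T r θ))
    (fun θ => by simp only [periodic_torusPolar T r θ]) φ

lemma radialCorr_triangle {D : Set (AddCircle T × AddCircle T)} (hD : MeasurableSet D)
    (h : radialCorr (D.indicator 1) 1 = 0) {β : ℝ} (hβ : 0 ≤ β) :
    2 * radialCorr (D.indicator 1) (√(3 * β ^ 2 + 3 * β + 1)) +
      radialCorr (D.indicator 1) (√(3 * β ^ 2)) ≤ density T D := by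
  have hp := isDens_indicator hD
  have h3 : √3 ^ 2 = 3 := Real.sq_sqrt (by norm_num)
  obtain ⟨φ, hc, hs⟩ := exists_polar (√3 * β + √3 / 2) (1 / 2)
  have e1 : √((√3 * β + √3 / 2) ^ 2 + (1 / 2) ^ 2) = √(3 * β ^ 2 + 3 * β + 1) := by
    congr 1
    linear_combination (β ^ 2 + β + 1 / 4) * h3
  have e2 : √(3 * β ^ 2) = √3 * β := by
    rw [Real.sqrt_mul (by norm_num), Real.sqrt_sq hβ]
  rw [e1] at hc hs
  rw [e2]
  set a := √(3 * β ^ 2 + 3 * β + 1)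
  have hcont : ∀ r ψ, Continuous fun θ => corr (D.indicator 1) (torusPolar T r (θ + ψ)) := fun r ψ =>
    (continuous_corr hp).comp ((continuous_torusPolar r).comp (by fun_prop))
  have key : ∀ θ, corr (D.indicator 1) (torusPolar T a (θ + φ)) +
      corr (D.indicator 1) (torusPolar T a (θ + -φ)) +
      corr (D.indicator 1) (torusPolar T (√3 * β) (θ + 0)) ≤ density T D := by
    intro θ
    refine corr_triangle hD (corr_torusPolar_eq_zero hp h (θ + Real.pi / 2)) (torusPolar_sub ?_ ?_)
      (corr_torusPolar_eq_zero hp h (θ + Real.pi / 6)) (torusPolar_sub ?_ ?_)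
      (corr_torusPolar_eq_zero hp h (θ + -(Real.pi / 6))) (torusPolar_sub ?_ ?_) <;>
    simp only [Real.cos_add, Real.sin_add, Real.cos_neg, Real.sin_neg, Real.cos_pi_div_two,
      Real.sin_pi_div_two, Real.cos_pi_div_six, Real.sin_pi_div_six, add_zero]
    · linear_combination (2 * Real.sin θ) * hs
    · linear_combination (-2 * Real.cos θ) * hs
    · linear_combination (Real.sin θ) * hs - Real.cos θ * hc
    · linear_combination (-Real.cos θ) * hs - Real.sin θ * hc
    · linear_combination (-Real.sin θ) * hs - Real.cos θ * hc
    · linear_combination (Real.cos θ) * hs - Real.sin θ * hc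
  have := angleAvg_mono (by exact ((hcont _ _).add (hcont _ _)).add (hcont _ _)) continuous_const key
  rw [angleAvg_const, angleAvg_add (by exact (hcont _ _).add (hcont _ _)) (hcont _ _),
    angleAvg_add (hcont _ _) (hcont _ _), angleAvg_corr_shift, angleAvg_corr_shift,
    angleAvg_corr_shift] at this
  linarith

lemma corr_indicator_zero {D : Set (AddCircle T × AddCircle T)} (hD : MeasurableSet D) :
    corr (D.indicator 1) 0 = density T D := by
  rw [corr_indicator hD, autocorr]
  simp

lemma charFreq_nonneg (k : Fin 2 → ℤ) : 0 ≤ charFreq T k := by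
  have := hT.out
  unfold charFreq
  positivity

lemma cluster_inequality {D : Set (AddCircle T × AddCircle T)} (hD : MeasurableSet D)
    (h : radialCorr (D.indicator 1) 1 = 0) :
    1.3475 * density T D ^ 2 ≤
      0.2266 * density T D + 0.3462 * radialCorr (D.indicator 1) 1.96 := by
  have hp := isDens_indicator hD
  have s0 := hasSum_corr hp 0
  simp only [torusChar_zero, Complex.one_re, mul_one, corr_indicator_zero hD] at s0
  have s1 := hasSum_radialCorr hp (r := 1) zero_le_one
  have s2 := hasSum_radialCorr hp (r := 1.96) (by norm_num)
  have s3 := hasSum_radialCorr hp (r := √(91 / 64)) (Real.sqrt_nonneg _)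
  have s4 := hasSum_radialCorr hp (r := √(3 / 64)) (Real.sqrt_nonneg _)
  have s5 := hasSum_radialCorr hp (r := √(43 / 25)) (Real.sqrt_nonneg _)
  have s6 := hasSum_radialCorr hp (r := √(3 / 25)) (Real.sqrt_nonneg _)
  have S := ((((s0.mul_left 0.1102).add (s1.mul_left 0.5419)).add (s2.mul_left 0.3462)).add
    (((s3.mul_left 2).add s4).mul_left 0.0528)).add (((s5.mul_left 2).add s6).mul_left 0.0636)
  have e : ∀ k, 0.1102 * coefSq (D.indicator 1) k +
      0.5419 * (coefSq (D.indicator 1) k * besselJ (1 * charFreq T k)) +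
      0.3462 * (coefSq (D.indicator 1) k * besselJ (1.96 * charFreq T k)) +
      0.0528 * (2 * (coefSq (D.indicator 1) k * besselJ (√(91 / 64) * charFreq T k)) +
        coefSq (D.indicator 1) k * besselJ (√(3 / 64) * charFreq T k)) +
      0.0636 * (2 * (coefSq (D.indicator 1) k * besselJ (√(43 / 25) * charFreq T k)) +
        coefSq (D.indicator 1) k * besselJ (√(3 / 25) * charFreq T k)) =
      coefSq (D.indicator 1) k * clusterWeight (charFreq T k) := fun k => by
    rw [clusterWeight, one_mul]
    ring
  have hle := le_hasSum S 0 fun k _ => (mul_nonneg (coefSq_nonneg _ k)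
    (clusterWeight_nonneg (charFreq_nonneg k))).trans_eq (e k).symm
  rw [e, coefSq_zero, integral_indicator_eq_density hD, show charFreq T 0 = 0 by simp [charFreq]] at hle
  have hw : clusterWeight 0 = 1.3475 := by
    simp [clusterWeight, besselJ_zero]
    norm_num
  rw [hw, h] at hle
  have t1 := radialCorr_triangle hD h (β := 1 / 8) (by norm_num)
  have t2 := radialCorr_triangle hD h (β := 1 / 5) (by norm_num)
  norm_num at t1 t2 hle ⊢
  linarith

lemma le_radialCorr_of_density {D : Set (AddCircle T × AddCircle T)} (hD : MeasurableSet D)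
    (h : radialCorr (D.indicator 1) 1 = 0) (hd : 0.2264 ≤ density T D) :
    1.001 * density T D ^ 2 ≤ radialCorr (D.indicator 1) 1.96 := by
  have := cluster_inequality hD h
  have h2 : 0.2266 * density T D ≤ 0.2266 / 0.2264 * density T D ^ 2 := by
    rw [sq, div_mul_eq_mul_div, le_div_iff₀ (by norm_num)]
    nlinarith
  have h3 : 0.2266 / 0.2264 * density T D ^ 2 ≤ 1.0009 * density T D ^ 2 :=
    mul_le_mul_of_nonneg_right (by norm_num) (sq_nonneg _)
  nlinarith [sq_nonneg (density T D)]

end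

noncomputable section

/-- The space of measurable functions on the torus with values in `[0, 1]`. -/
def Dens (T : ℝ) : Type := {p : AddCircle T × AddCircle T → ℝ // IsDens p}

variable {T : ℝ} [hT : Fact (0 < T)]

/-- The functional on `L²` represented by a function with values in `[0, 1]`. -/
def Dens.toWeakDual (p : Dens T) : WeakDual ℝ (Lp ℝ 2 (torusHaar T)) :=
  StrongDual.toWeakDual (InnerProductSpace.toDual ℝ _ (p.2.memLp 2).toLp)

instance : TopologicalSpace (Dens T) := TopologicalSpace.induced Dens.toWeakDual inferInstance

lemma Dens.toWeakDual_toLp (p : Dens T) {g : AddCircle T × AddCircle T → ℝ}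
    (hg : MemLp g 2 (torusHaar T)) : p.toWeakDual hg.toLp = ∫ y, p.1 y * g y ∂torusHaar T := by
  change inner ℝ (p.2.memLp 2).toLp hg.toLp = _
  rw [L2.inner_def]
  refine integral_congr_ae ?_
  filter_upwards [(p.2.memLp 2).coeFn_toLp, hg.coeFn_toLp] with y h1 h2
  rw [h1, h2, real_inner_eq_re_inner, RCLike.inner_apply]
  simp [mul_comm]

lemma Dens.continuous_integral {g : AddCircle T × AddCircle T → ℝ}
    (hg : MemLp g 2 (torusHaar T)) :
    Continuous fun p : Dens T => ∫ y, p.1 y * g y ∂torusHaar T := by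
  simp_rw [← fun p : Dens T => p.toWeakDual_toLp hg]
  exact (WeakDual.eval_continuous hg.toLp).comp continuous_induced_dom

lemma memLp_indicator_one {B : Set (AddCircle T × AddCircle T)} (hB : MeasurableSet B) (q : ℝ≥0∞) :
    MemLp (B.indicator 1 : _ → ℝ) q (torusHaar T) := (isDens_indicator hB).memLp q

lemma mul_indicator_one {α : Type*} (f : α → ℝ) (B : Set α) :
    (fun y => f y * B.indicator 1 y) = B.indicator f := by
  ext y
  by_cases h : y ∈ B <;> simp [h]

lemma range_toWeakDual : Set.range (Dens.toWeakDual (T := T)) =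
    WeakDual.toStrongDual ⁻¹' Metric.closedBall 0 1 ∩
      {l | ∀ B, ∀ hB : MeasurableSet B, l (memLp_indicator_one hB 2).toLp ∈
        Set.Icc 0 ((torusHaar T).real B)} := by
  ext l
  constructor
  · rintro ⟨p, rfl⟩
    refine ⟨?_, fun B hB => ?_⟩
    · change InnerProductSpace.toDual ℝ _ (p.2.memLp 2).toLp ∈ Metric.closedBall 0 1
      rw [mem_closedBall_zero_iff, LinearIsometryEquiv.norm_map, Lp.norm_toLp]
      refine ENNReal.toReal_le_of_le_ofReal zero_le_one ?_
      refine (eLpNorm_le_of_ae_bound (C := 1) (ae_of_all _ fun x => ?_)).trans (by simp)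
      rw [Real.norm_of_nonneg (p.2.nonneg x)]
      exact p.2.le_one x
    · rw [p.toWeakDual_toLp, mul_indicator_one, integral_indicator hB]
      refine ⟨integral_nonneg p.2.nonneg, ?_⟩
      refine (integral_mono p.2.integrable.integrableOn (integrable_const 1) p.2.le_one).trans ?_
      simp
  · rintro ⟨-, hl⟩
    obtain ⟨g, hg⟩ := (InnerProductSpace.toDual ℝ (Lp ℝ 2 (torusHaar T))).surjective
      (WeakDual.toStrongDual l)
    have hgi : Integrable g (torusHaar T) := (Lp.memLp g).integrable one_le_two
    have key : ∀ B, MeasurableSet B → ∫ y in B, g y ∂torusHaar T ∈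
        Set.Icc 0 ((torusHaar T).real B) := by
      intro B hB
      convert hl B hB using 1
      change _ = WeakDual.toStrongDual l _
      rw [← hg]
      change _ = inner ℝ g _
      rw [L2.inner_def, ← integral_indicator hB, ← mul_indicator_one]
      refine integral_congr_ae ?_
      filter_upwards [(memLp_indicator_one hB 2).coeFn_toLp] with y h1
      rw [h1, real_inner_eq_re_inner, RCLike.inner_apply]
      simp [mul_comm]
    have h0 : 0 ≤ᵐ[torusHaar T] g :=
      ae_nonneg_of_forall_setIntegral_nonneg hgi fun B hB _ => (key B hB).1
    have h1 : g ≤ᵐ[torusHaar T] 1 := by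
      refine ae_le_of_forall_setIntegral_le hgi (integrable_const 1) fun B hB _ => ?_
      refine (key B hB).2.trans ?_
      simp
    have hm : Measurable g := (Lp.stronglyMeasurable g).measurable
    have hp : IsDens fun x => max 0 (min 1 (g x)) :=
      { measurable := measurable_const.max (measurable_const.min hm)
        nonneg := fun x => le_max_left _ _
        le_one := fun x => max_le zero_le_one (min_le_left _ _) }
    refine ⟨⟨_, hp⟩, ?_⟩
    have : (hp.memLp 2).toLp = g := by
      apply Lp.ext
      filter_upwards [(hp.memLp 2).coeFn_toLp, h0, h1] with x hx hx0 hx1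
      rw [hx, min_eq_right (by exact hx1), max_eq_right (by exact hx0)]
    change StrongDual.toWeakDual (InnerProductSpace.toDual ℝ _ (hp.memLp 2).toLp) = l
    rw [this, hg]
    rfl

instance : CompactSpace (Dens T) := by
  refine ⟨(Topology.IsInducing.isCompact_iff ⟨rfl⟩ (f := Dens.toWeakDual (T := T))).2 ?_⟩
  rw [Set.image_univ, range_toWeakDual]
  refine (WeakDual.isCompact_closedBall (𝕜 := ℝ) _ _).inter_right ?_
  simp only [Set.ofPred_forall]
  exact isClosed_iInter fun B => isClosed_iInter fun hB =>
    isClosed_Icc.preimage (WeakDual.eval_continuous _)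

lemma continuous_coefSq (k : Fin 2 → ℤ) : Continuous fun p : Dens T => coefSq p.1 k := by
  have hb : ∀ f : ℂ → ℝ, Continuous f → (∀ z, |f z| ≤ ‖z‖) →
      MemLp (fun y => f (torusChar T k y)) 2 (torusHaar T) := fun f hf h =>
    MemLp.of_bound (hf.comp (continuous_torusChar k)).aestronglyMeasurable 1
      (ae_of_all _ fun x => (h _).trans (norm_torusChar k x).le)
  exact ((Dens.continuous_integral (hb _ Complex.continuous_re Complex.abs_re_le_norm)).pow 2).add
    ((Dens.continuous_integral (hb _ Complex.continuous_im Complex.abs_im_le_norm)).pow 2)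

lemma tendsto_besselJ_atTop : Tendsto besselJ atTop (𝓝 0) := by
  have h : Tendsto (fun t : ℝ => 0.8 / √t) atTop (𝓝 0) :=
    tendsto_const_nhds.div_atTop Real.tendsto_sqrt_atTop
  refine squeeze_zero_norm' ?_ h
  filter_upwards [eventually_ge_atTop 8] with t ht using abs_besselJ_le ht

lemma tendsto_charFreq : Tendsto (charFreq T) cofinite atTop := by
  have h0 := hT.out
  have hpi := Real.pi_pos
  have h1 : Tendsto (fun k : Fin 2 → ℤ => ‖k‖) cofinite atTop := by
    rw [← cocompact_eq_cofinite]
    exact tendsto_norm_cocompact_atTop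
  refine tendsto_atTop_mono (f := fun k => 2 * Real.pi / T * ‖k‖) (fun k => ?_)
    (h1.const_mul_atTop (by positivity))
  refine mul_le_mul_of_nonneg_left ?_ (by positivity)
  refine (pi_norm_le_iff_of_nonneg (Real.sqrt_nonneg _)).2 fun i => ?_
  refine Real.le_sqrt_of_sq_le ?_
  rw [Int.norm_eq_abs, sq_abs]
  fin_cases i
  · simp
    positivity
  · simp
    positivity

lemma continuous_radialCorr {r : ℝ} (hr : 0 < r) :
    Continuous fun p : Dens T => radialCorr p.1 r := by
  have hJ : Tendsto (fun k => besselJ (r * charFreq T k)) cofinite (𝓝 0) :=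
    tendsto_besselJ_atTop.comp (tendsto_charFreq.const_mul_atTop hr)
  have hu : TendstoUniformly (fun (s : Finset (Fin 2 → ℤ)) (p : Dens T) =>
      ∑ k ∈ s, coefSq p.1 k * besselJ (r * charFreq T k)) (fun p => radialCorr p.1 r) atTop := by
    rw [Metric.tendstoUniformly_iff]
    intro ε hε
    have hfin : {k | ¬ |besselJ (r * charFreq T k)| < ε / 2}.Finite := by
      have := hJ.eventually (Metric.ball_mem_nhds 0 (half_pos hε))
      simpa [eventually_cofinite] using this
    filter_upwards [eventually_ge_atTop hfin.toFinset] with s hs p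
    have hsum := hasSum_radialCorr p.2 hr.le
    have h2 : HasSum (fun k => if k ∈ s then coefSq p.1 k * besselJ (r * charFreq T k) else 0)
        (∑ k ∈ s, coefSq p.1 k * besselJ (r * charFreq T k)) := by
      rw [← Finset.sum_congr rfl fun k (hk : k ∈ s) => if_pos hk]
      exact hasSum_sum_of_ne_finset_zero fun k hk => if_neg hk
    rw [dist_eq_norm, ← (hsum.sub h2).tsum_eq]
    refine (tsum_of_norm_bounded ((summable_coefSq p.2).hasSum.mul_left (ε / 2)) fun k => ?_).trans_lt
      ?_
    · split_ifs with hk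
      · simpa using mul_nonneg (half_pos hε).le (coefSq_nonneg p.1 k)
      · have : |besselJ (r * charFreq T k)| < ε / 2 := by
          by_contra hcon
          exact hk (hs (hfin.mem_toFinset.2 hcon))
        rw [sub_zero, norm_mul, Real.norm_of_nonneg (coefSq_nonneg _ _), mul_comm]
        exact mul_le_mul_of_nonneg_right this.le (coefSq_nonneg _ _)
    · have := tsum_coefSq_le_one p.2
      nlinarith
  exact hu.continuous (Frequently.of_forall fun s =>
    continuous_finsetSum _ fun k _ => (continuous_coefSq k).mul continuous_const)

end

lemma AddCircle.norm_coe_le_abs {T : ℝ} (x : ℝ) : ‖(x : AddCircle T)‖ ≤ |x| :=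
  QuotientAddGroup.norm_mk_le_norm

lemma AddCircle.exists_abs_eq_norm {T : ℝ} (x : AddCircle T) : ∃ a : ℝ, (a : AddCircle T) = x ∧ |a| = ‖x‖ := by
  induction x using QuotientAddGroup.induction_on with
  | H x =>
    refine ⟨x - round (T⁻¹ * x) * T, ?_, (AddCircle.norm_eq T).symm⟩
    rw [AddCircle.coe_sub, sub_eq_self, AddCircle.coe_eq_zero_iff]
    exact ⟨round (T⁻¹ * x), by simp⟩

lemma torusDist_add_torusPolar {T : ℝ} (hT : 2 ≤ T) (x : AddCircle T × AddCircle T) (θ : ℝ) :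
    torusDist x (x + torusPolar T 1 θ) = 1 := by
  have h : ∀ c : ℝ, |c| ≤ 1 → ‖(c : AddCircle T)‖ = |c| := fun c hc =>
    (AddCircle.norm_coe_eq_abs_iff T (by linarith)).2 (by
      rw [abs_of_pos (show 0 < T by linarith)]
      linarith)
  simp [torusDist, torusPolar, h _ (Real.abs_cos_le_one θ), h _ (Real.abs_sin_le_one θ)]

lemma exists_torusPolar_of_torusDist {T : ℝ} {x y : AddCircle T × AddCircle T}
    (h : torusDist x y = 1) : ∃ θ, y = x + torusPolar T 1 θ := by
  obtain ⟨a, ha, ha'⟩ := AddCircle.exists_abs_eq_norm (y.1 - x.1)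
  obtain ⟨b, hb, hb'⟩ := AddCircle.exists_abs_eq_norm (y.2 - x.2)
  obtain ⟨φ, h1, h2⟩ := exists_polar a b
  have e : √(a ^ 2 + b ^ 2) = 1 := by
    rw [← h, torusDist, norm_sub_rev x.1, norm_sub_rev x.2, ← ha', ← hb', sq_abs, sq_abs]
  rw [e] at h1 h2
  refine ⟨φ, ?_⟩
  rw [torusPolar, ← h1, ← h2, ha, hb]
  ext <;> simp

lemma torusDist_lt_one_of_mem_gridSquare {K N : ℕ} (hN : 2 ≤ N) {v : Fin (N * K) × Fin (N * K)}
    {x y : AddCircle (K : ℝ) × AddCircle (K : ℝ)} (hx : x ∈ gridSquare K N v)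
    (hy : y ∈ gridSquare K N v) : torusDist x y < 1 := by
  obtain ⟨p, rfl, h1, h2, h3, h4⟩ := hx
  obtain ⟨q, rfl, h5, h6, h7, h8⟩ := hy
  have hN' : (2 : ℝ) ≤ N := by exact_mod_cast hN
  have hinv : 1 / (N : ℝ) ≤ 1 / 2 := one_div_le_one_div_of_le (by norm_num) hN'
  rw [add_div] at h2 h4 h6 h8
  have key : ∀ a b : ℝ, |a - b| ≤ 1 / 2 → ‖(a : AddCircle (K : ℝ)) - b‖ ^ 2 ≤ (1 / 2) ^ 2 := by
    intro a b hab
    refine pow_le_pow_left₀ (norm_nonneg _) ?_ 2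
    rw [← AddCircle.coe_sub]
    exact (AddCircle.norm_coe_le_abs _).trans hab
  rw [torusDist, Real.sqrt_lt' one_pos]
  have e1 := key p.1 q.1 (abs_le.2 ⟨by linarith, by linarith⟩)
  have e2 := key p.2 q.2 (abs_le.2 ⟨by linarith, by linarith⟩)
  norm_num at e1 e2 ⊢
  linarith

lemma isCompact_gridSquare (K N : ℕ) (v : Fin (N * K) × Fin (N * K)) :
    IsCompact (gridSquare K N v) := by
  have h : gridSquare K N v =
      (fun p : ℝ × ℝ => ((p.1 : AddCircle (K : ℝ)), (p.2 : AddCircle (K : ℝ)))) ''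
      (Set.Icc ((v.1 : ℝ) / N) (((v.1 : ℝ) + 1) / N) ×ˢ
        Set.Icc ((v.2 : ℝ) / N) (((v.2 : ℝ) + 1) / N)) := by
    ext q
    constructor
    · rintro ⟨p, rfl, h1, h2, h3, h4⟩
      exact ⟨p, ⟨⟨h1, h2⟩, ⟨h3, h4⟩⟩, rfl⟩
    · rintro ⟨p, ⟨⟨h1, h2⟩, ⟨h3, h4⟩⟩, rfl⟩
      exact ⟨p, rfl, h1, h2, h3, h4⟩
  rw [h]
  exact (isCompact_Icc.prod isCompact_Icc).image
    (((AddCircle.continuous_mk' _).comp continuous_fst).prodMk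
      ((AddCircle.continuous_mk' _).comp continuous_snd))

lemma measurableSet_gridSquare (K N : ℕ) (v : Fin (N * K) × Fin (N * K)) :
    MeasurableSet (gridSquare K N v) := (isCompact_gridSquare K N v).isClosed.measurableSet

lemma measurableSet_unionSquares (K N : ℕ) (F : Finset (Fin (N * K) × Fin (N * K))) :
    MeasurableSet (unionSquares K N F) :=
  F.measurableSet_biUnion fun v _ => measurableSet_gridSquare K N v

lemma exists_mem_gridSquare {K N : ℕ} [hK : Fact (0 < (K : ℝ))] (hN : 0 < N)
    (x : AddCircle (K : ℝ) × AddCircle (K : ℝ)) : ∃ v, x ∈ gridSquare K N v := by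
  have hN' : (0 : ℝ) < N := by exact_mod_cast hN
  have key : ∀ z : AddCircle (K : ℝ), ∃ j : Fin (N * K), ∃ a : ℝ, z = a ∧ (j : ℝ) / N ≤ a ∧
      a ≤ ((j : ℝ) + 1) / N := by
    intro z
    obtain ⟨a, ha, rfl⟩ := AddCircle.eq_coe_Ico z
    have h1 : (⌊a * N⌋₊ : ℝ) ≤ a * N := Nat.floor_le (mul_nonneg ha.1 hN'.le)
    have h2 : a * N < ⌊a * N⌋₊ + 1 := Nat.lt_floor_add_one _
    refine ⟨⟨⌊a * N⌋₊, ?_⟩, a, rfl, (div_le_iff₀ hN').2 h1, (le_div_iff₀ hN').2 h2.le⟩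
    have h3 : (⌊a * N⌋₊ : ℝ) < N * K := by nlinarith [ha.2]
    exact_mod_cast h3
  obtain ⟨i, a, ha, h1, h2⟩ := key x.1
  obtain ⟨j, b, hb, h3, h4⟩ := key x.2
  exact ⟨(i, j), (a, b), Prod.ext ha hb, h1, h2, h3, h4⟩

section

variable {K N : ℕ} [hK : Fact (0 < (K : ℝ))]

lemma torusHaar_real_gridSquare_le (hN : 0 < N) (v : Fin (N * K) × Fin (N * K)) :
    (torusHaar (K : ℝ)).real (gridSquare K N v) ≤ 1 / ((N * K : ℕ) : ℝ) ^ 2 := by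
  have hN' : (0 : ℝ) < N := by exact_mod_cast hN
  have hK' := hK.out
  have hball : ∀ c : AddCircle (K : ℝ), (AddCircle.haarAddCircle (T := (K : ℝ))).real
      (Metric.closedBall c (1 / (2 * N))) ≤ 1 / ((N * K : ℕ) : ℝ) := by
    intro c
    have h := congrArg ENNReal.toReal (AddCircle.volume_closedBall (K : ℝ) (x := c) (1 / (2 * N)))
    rw [AddCircle.volume_eq_smul_haarAddCircle, Measure.smul_apply, smul_eq_mul, ENNReal.toReal_mul,
      ENNReal.toReal_ofReal hK'.le, ENNReal.toReal_ofReal (by positivity)] at h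
    rw [Measure.real, Nat.cast_mul, le_div_iff₀ (by positivity), mul_comm, mul_assoc, h]
    refine (mul_le_mul_of_nonneg_left (min_le_right _ _) hN'.le).trans_eq ?_
    field_simp
  have hsub : gridSquare K N v ⊆
      Metric.closedBall (((((v.1 : ℝ) + 1 / 2) / N : ℝ)) : AddCircle (K : ℝ)) (1 / (2 * N)) ×ˢ
      Metric.closedBall (((((v.2 : ℝ) + 1 / 2) / N : ℝ)) : AddCircle (K : ℝ)) (1 / (2 * N)) := by
    have key : ∀ a j : ℝ, j / N ≤ a → a ≤ (j + 1) / N →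
        (a : AddCircle (K : ℝ)) ∈ Metric.closedBall (((j + 1 / 2) / N : ℝ) : AddCircle (K : ℝ))
          (1 / (2 * N)) := by
      intro a j h1 h2
      rw [Metric.mem_closedBall, dist_eq_norm, ← AddCircle.coe_sub]
      refine (AddCircle.norm_coe_le_abs _).trans ?_
      have e : 1 / (2 * (N : ℝ)) = 1 / 2 / N := by field_simp
      rw [add_div] at h2 ⊢
      have e2 : 1 / (N : ℝ) = 1 / 2 / N + 1 / 2 / N := by ring
      rw [e, abs_le]
      constructor <;> linarith
    rintro _ ⟨p, rfl, h1, h2, h3, h4⟩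
    exact ⟨key _ _ h1 h2, key _ _ h3 h4⟩
  refine (measureReal_mono hsub).trans ?_
  rw [measureReal_prod_prod, ← one_div_pow, sq]
  exact mul_le_mul (hball _) (hball _) measureReal_nonneg (by positivity)

lemma torusHaar_real_unionSquares (hN : 0 < N) (F : Finset (Fin (N * K) × Fin (N * K))) :
    (torusHaar (K : ℝ)).real (unionSquares K N F) = F.card / ((N * K : ℕ) : ℝ) ^ 2 := by
  have hN' : (0 : ℝ) < N := by exact_mod_cast hN
  have hK' := hK.out
  have hle : ∀ F : Finset (Fin (N * K) × Fin (N * K)),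
      (torusHaar (K : ℝ)).real (unionSquares K N F) ≤ F.card / ((N * K : ℕ) : ℝ) ^ 2 := by
    intro F
    refine (measureReal_biUnion_finset_le F _).trans ?_
    refine (Finset.sum_le_card_nsmul F _ _ fun v _ => torusHaar_real_gridSquare_le hN v).trans_eq ?_
    rw [nsmul_eq_mul, mul_one_div]
  refine (hle F).antisymm ?_
  have h1 : (1 : ℝ) ≤ (torusHaar (K : ℝ)).real (unionSquares K N F) +
      (torusHaar (K : ℝ)).real (unionSquares K N Fᶜ) := by
    have huniv : unionSquares K N F ∪ unionSquares K N Fᶜ = Set.univ := by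
      refine Set.eq_univ_of_forall fun x => ?_
      obtain ⟨v, hv⟩ := exists_mem_gridSquare hN x
      by_cases hvF : v ∈ F
      · exact Or.inl (Set.mem_biUnion hvF hv)
      · exact Or.inr (Set.mem_biUnion (Finset.mem_compl.2 hvF) hv)
    have := measureReal_union_le (μ := torusHaar (K : ℝ)) (unionSquares K N F) (unionSquares K N Fᶜ)
    rw [huniv] at this
    simpa using this
  have h2 := hle Fᶜ
  have h3 : (F.card : ℝ) / ((N * K : ℕ) : ℝ) ^ 2 + (Fᶜ.card : ℝ) / ((N * K : ℕ) : ℝ) ^ 2 = 1 := by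
    rw [← add_div, ← Nat.cast_add, Finset.card_add_card_compl, Fintype.card_prod, Fintype.card_fin]
    push_cast
    field_simp
  linarith

lemma torusHaar_real_gridSquare (hN : 0 < N) (v : Fin (N * K) × Fin (N * K)) :
    (torusHaar (K : ℝ)).real (gridSquare K N v) = 1 / ((N * K : ℕ) : ℝ) ^ 2 := by
  have := torusHaar_real_unionSquares hN {v}
  simpa [unionSquares] using this

lemma ae_unique_gridSquare (hN : 0 < N) : ∀ᵐ y ∂torusHaar (K : ℝ), ∀ v w,
    y ∈ gridSquare K N v → y ∈ gridSquare K N w → v = w := by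
  rw [ae_all_iff]
  intro v
  rw [ae_all_iff]
  intro w
  by_cases hvw : v = w
  · exact ae_of_all _ fun _ _ _ => hvw
  have h := measureReal_union_add_inter (μ := torusHaar (K : ℝ)) (s := gridSquare K N v)
    (measurableSet_gridSquare K N w)
  have h2 := torusHaar_real_unionSquares hN {v, w}
  rw [Finset.card_pair hvw] at h2
  simp only [unionSquares, Finset.mem_insert, Finset.mem_singleton, Set.iUnion_iUnion_eq_or_left,
    Set.iUnion_iUnion_eq_left] at h2
  rw [h2, torusHaar_real_gridSquare hN, torusHaar_real_gridSquare hN] at h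
  have h3 : (torusHaar (K : ℝ)).real (gridSquare K N v ∩ gridSquare K N w) = 0 := by
    push_cast at h
    linear_combination h
  rw [measureReal_eq_zero_iff] at h3
  filter_upwards [measure_eq_zero_iff_ae_notMem.1 h3] with y hy h4 h5
  exact absurd ⟨h4, h5⟩ hy

lemma ae_indicator_unionSquares (hN : 0 < N) : ∀ᵐ y ∂torusHaar (K : ℝ),
    ∀ F : Finset (Fin (N * K) × Fin (N * K)), (unionSquares K N F).indicator (1 : AddCircle (K : ℝ) × AddCircle (K : ℝ) → ℝ) y =
      ∑ v ∈ F, (gridSquare K N v).indicator 1 y := by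
  filter_upwards [ae_unique_gridSquare hN] with y hy F
  by_cases h : y ∈ unionSquares K N F
  · obtain ⟨v, hv, hyv⟩ := Set.mem_iUnion₂.1 h
    rw [Set.indicator_of_mem h, Finset.sum_eq_single_of_mem v hv, Set.indicator_of_mem hyv]
    intro w _ hw
    exact Set.indicator_of_notMem (fun hyw => hw (hy _ _ hyw hyv)) _
  · rw [Set.indicator_of_notMem h, Finset.sum_eq_zero]
    intro v hv
    exact Set.indicator_of_notMem (fun hyv => h (Set.mem_biUnion hv hyv)) _

lemma radialCorr_unionSquares_eq_zero (hN : 2 ≤ N) (hK2 : 2 ≤ K)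
    {F : Finset (Fin (N * K) × Fin (N * K))} (hF : IsIndep (unitGraph K N) F) :
    radialCorr ((unionSquares K N F).indicator 1) 1 = 0 := by
  have key : ∀ θ, corr ((unionSquares K N F).indicator 1) (torusPolar (K : ℝ) 1 θ) = 0 := by
    intro θ
    have h0 : ∀ y : AddCircle (K : ℝ) × AddCircle (K : ℝ),
        (unionSquares K N F).indicator (1 : AddCircle (K : ℝ) × AddCircle (K : ℝ) → ℝ) y *
          (unionSquares K N F).indicator 1 (y + torusPolar (K : ℝ) 1 θ) = 0 := by
      intro y
      by_contra hne
      have h1 := Set.mem_of_indicator_ne_zero (left_ne_zero_of_mul hne)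
      have h2 := Set.mem_of_indicator_ne_zero (right_ne_zero_of_mul hne)
      obtain ⟨v, hv, hyv⟩ := Set.mem_iUnion₂.1 h1
      obtain ⟨w, hw, hyw⟩ := Set.mem_iUnion₂.1 h2
      have hd := torusDist_add_torusPolar (T := K) (by exact_mod_cast hK2) y θ
      refine hF v hv w hw ((SimpleGraph.fromRel_adj _ _ _).2 ⟨?_, Or.inl ⟨y, hyv, _, hyw, hd⟩⟩)
      rintro rfl
      exact (torusDist_lt_one_of_mem_gridSquare hN hyv hyw).ne hd
    simp only [corr, h0, integral_zero]
  simp only [radialCorr, key, angleAvg_const]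

end

lemma radialCorr_support_eq_zero {T : ℝ} [Fact (0 < T)] {p : AddCircle T × AddCircle T → ℝ}
    (hp : IsDens p) {r : ℝ} (h : radialCorr p r = 0) :
    radialCorr ({x | 0 < p x}.indicator 1) r = 0 := by
  have key : ∀ θ, corr ({x | 0 < p x}.indicator 1) (torusPolar T r θ) = 0 := by
    intro θ
    refine integral_eq_zero_of_ae ?_
    have := ae_mul_eq_zero_of_corr hp (u := 0) (corr_torusPolar_eq_zero hp h θ) (sub_zero _)
    filter_upwards [this] with y hy
    rw [add_zero] at hy
    by_contra hne
    have h1 := Set.mem_of_indicator_ne_zero (left_ne_zero_of_mul hne)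
    have h2 := Set.mem_of_indicator_ne_zero (right_ne_zero_of_mul hne)
    exact (mul_pos h1 h2).ne' hy
  simp only [radialCorr, key, angleAvg_const]

section

lemma card_le_prod_of_le_sum {V : Type*} [Fintype V] [DecidableEq V] (S : Finset (Finset V))
    (t : V → ℝ) {c : ℝ} (hc : ∀ I ∈ S, c ≤ ∑ v ∈ I, t v) :
    (S.card : ℝ) ≤ Real.exp (∑ v, Real.log (1 + Real.exp (t v)) - c) := by
  have h1 : ∑ I : Finset V, Real.exp (∑ v ∈ I, t v) = ∏ v, (1 + Real.exp (t v)) := by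
    rw [Finset.prod_one_add, Finset.powerset_univ]
    simp only [Real.exp_sum]
  have h2 : (S.card : ℝ) * Real.exp c ≤ ∑ I : Finset V, Real.exp (∑ v ∈ I, t v) := by
    rw [← nsmul_eq_mul]
    refine (Finset.card_nsmul_le_sum S _ _ fun I hI => Real.exp_le_exp.2 (hc I hI)).trans ?_
    exact Finset.sum_le_univ_sum_of_nonneg fun I => (Real.exp_pos _).le
  rw [Real.exp_sub, Real.exp_sum, le_div_iff₀ (Real.exp_pos _)]
  refine h2.trans_eq (h1.trans (Finset.prod_congr rfl fun v _ => ?_))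
  rw [Real.exp_log (by positivity)]

lemma softplus_tangent (s t : ℝ) : Real.log (1 + Real.exp s) +
    Real.exp s / (1 + Real.exp s) * (t - s) ≤ Real.log (1 + Real.exp t) := by
  have hs : 0 < 1 + Real.exp s := by positivity
  rw [Real.le_log_iff_exp_le (by positivity), Real.exp_add, Real.exp_log hs]
  have h1 : 0 ≤ 1 / (1 + Real.exp s) := by positivity
  have h2 : 0 ≤ Real.exp s / (1 + Real.exp s) := by positivity
  have h := convexOn_exp.2 (Set.mem_univ 0) (Set.mem_univ (t - s)) h1 h2
    (by rw [← add_div, div_self hs.ne'])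
  simp only [smul_eq_mul, mul_zero, zero_add, Real.exp_zero, mul_one] at h
  refine (mul_le_mul_of_nonneg_left h hs.le).trans_eq ?_
  rw [Real.exp_sub]
  field_simp

lemma softplus_le (s : ℝ) : Real.log (1 + Real.exp s) ≤ Real.log 2 + s / 2 + s ^ 2 / 8 := by
  have h := Real.cosh_le_exp_half_sq (s / 2)
  rw [Real.log_le_iff_le_exp (by positivity), Real.exp_add, Real.exp_add, Real.exp_log (by norm_num)]
  have e : 1 + Real.exp s = 2 * Real.exp (s / 2) * Real.cosh (s / 2) := by
    rw [Real.cosh_eq]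
    have h1 : Real.exp (s / 2) * Real.exp (s / 2) = Real.exp s := by rw [← Real.exp_add]; ring_nf
    have h2 : Real.exp (s / 2) * Real.exp (-(s / 2)) = 1 := by rw [← Real.exp_add]; simp
    linear_combination -h1 - h2
  rw [e, show s ^ 2 / 8 = (s / 2) ^ 2 / 2 by ring]
  exact mul_le_mul_of_nonneg_left h (by positivity)

lemma softplus_le_exp (s : ℝ) : Real.log (1 + Real.exp s) ≤ Real.exp s := by
  have := Real.log_le_sub_one_of_pos (show 0 < 1 + Real.exp s by positivity)
  linarith

lemma softplus_nonneg (s : ℝ) : 0 ≤ Real.log (1 + Real.exp s) :=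
  Real.log_nonneg (by linarith [Real.exp_pos s])

lemma integrable_softplus {α : Type*} [MeasurableSpace α] {μ : Measure α} [IsFiniteMeasure μ]
    {f : α → ℝ} (hf : Measurable f) {R : ℝ} (hR : ∀ x, |f x| ≤ R) :
    Integrable (fun x => Real.log (1 + Real.exp (f x))) μ := by
  refine Integrable.of_bound (Real.measurable_log.comp
    (measurable_const.add (Real.measurable_exp.comp hf))).aestronglyMeasurable (Real.exp R) (ae_of_all _ fun x => ?_)
  rw [Real.norm_of_nonneg (softplus_nonneg _)]
  exact (softplus_le_exp _).trans (Real.exp_le_exp.2 ((le_abs_self _).trans (hR x)))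

variable {K N : ℕ} [hK : Fact (0 < (K : ℝ))]

lemma integral_indicator_mul_unionSquares (hN : 0 < N) {f : AddCircle (K : ℝ) × AddCircle (K : ℝ) → ℝ}
    (hf : Integrable f (torusHaar (K : ℝ))) (F : Finset (Fin (N * K) × Fin (N * K))) :
    ∫ y, (unionSquares K N F).indicator 1 y * f y ∂torusHaar (K : ℝ) =
      ∑ v ∈ F, ∫ y in gridSquare K N v, f y ∂torusHaar (K : ℝ) := by
  have h : ∀ v, ∫ y in gridSquare K N v, f y ∂torusHaar (K : ℝ) =
      ∫ y, (gridSquare K N v).indicator f y ∂torusHaar (K : ℝ) := fun v =>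
    (integral_indicator (measurableSet_gridSquare K N v)).symm
  simp_rw [h]
  rw [← integral_finsetSum _ fun v _ => hf.indicator (measurableSet_gridSquare K N v)]
  refine integral_congr_ae ?_
  filter_upwards [ae_indicator_unionSquares (K := K) hN] with y hy
  rw [hy, Finset.sum_mul]
  refine Finset.sum_congr rfl fun v _ => ?_
  by_cases h : y ∈ gridSquare K N v <;> simp [h]

lemma unionSquares_univ (hN : 0 < N) : unionSquares K N Finset.univ = Set.univ :=
  Set.eq_univ_of_forall fun x => by
    obtain ⟨v, hv⟩ := exists_mem_gridSquare hN x
    exact Set.mem_biUnion (Finset.mem_univ v) hv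

lemma card_le_exp_tilt (hN : 0 < N) {f : AddCircle (K : ℝ) × AddCircle (K : ℝ) → ℝ}
    (hf : Measurable f) {R : ℝ} (hR : ∀ x, |f x| ≤ R)
    (S : Finset (Finset (Fin (N * K) × Fin (N * K)))) {c : ℝ}
    (hc : ∀ I ∈ S, c ≤ ∫ y, (unionSquares K N I).indicator 1 y * f y ∂torusHaar (K : ℝ)) :
    (S.card : ℝ) ≤ Real.exp (((N * K : ℕ) : ℝ) ^ 2 *
      (∫ y, Real.log (1 + Real.exp (f y)) ∂torusHaar (K : ℝ) - c)) := by
  have hN' : (0 : ℝ) < N := by exact_mod_cast hN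
  have hK' := hK.out
  set n : ℝ := ((N * K : ℕ) : ℝ) ^ 2 with hn
  have hn0 : 0 < n := by
    rw [hn]
    push_cast
    positivity
  have hfi : Integrable f (torusHaar (K : ℝ)) :=
    Integrable.of_bound hf.aestronglyMeasurable R (ae_of_all _ hR)
  have hLi := integrable_softplus (μ := torusHaar (K : ℝ)) hf hR
  refine (card_le_prod_of_le_sum S
    (fun v => n * ∫ y in gridSquare K N v, f y ∂torusHaar (K : ℝ)) (c := n * c) ?_).trans ?_
  · intro I hI
    rw [← Finset.mul_sum, ← integral_indicator_mul_unionSquares hN hfi]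
    exact mul_le_mul_of_nonneg_left (hc I hI) hn0.le
  · rw [Real.exp_le_exp, mul_sub]
    refine sub_le_sub_right ?_ _
    have h1 : ∫ y, Real.log (1 + Real.exp (f y)) ∂torusHaar (K : ℝ) =
        ∑ v, ∫ y in gridSquare K N v, Real.log (1 + Real.exp (f y)) ∂torusHaar (K : ℝ) := by
      rw [← integral_indicator_mul_unionSquares hN hLi, unionSquares_univ hN]
      simp
    rw [h1, Finset.mul_sum]
    refine Finset.sum_le_sum fun v _ => ?_
    set s := n * ∫ y in gridSquare K N v, f y ∂torusHaar (K : ℝ) with hs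
    have hμ : (torusHaar (K : ℝ)).real (gridSquare K N v) = 1 / n := torusHaar_real_gridSquare hN v
    have h2 : ∫ y in gridSquare K N v, (Real.log (1 + Real.exp s) +
        Real.exp s / (1 + Real.exp s) * (f y - s)) ∂torusHaar (K : ℝ) ≤
        ∫ y in gridSquare K N v, Real.log (1 + Real.exp (f y)) ∂torusHaar (K : ℝ) :=
      integral_mono (by
        exact (integrable_const _).add ((hfi.integrableOn.sub (integrable_const _)).const_mul _))
        hLi.integrableOn fun y => softplus_tangent _ _
    rw [integral_add (integrable_const _)
      (by exact (hfi.integrableOn.sub (integrable_const _)).const_mul _), integral_const_mul,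
      integral_sub hfi.integrableOn (integrable_const _), setIntegral_const, setIntegral_const, hμ,
      smul_eq_mul, smul_eq_mul] at h2
    have h3 : ∫ y in gridSquare K N v, f y ∂torusHaar (K : ℝ) - 1 / n * s = 0 := by
      rw [hs]
      field_simp
      simp
    rw [h3, mul_zero, add_zero] at h2
    have := mul_le_mul_of_nonneg_left h2 hn0.le
    rwa [← mul_assoc, mul_one_div_cancel hn0.ne', one_mul] at this

lemma exists_tilt {T : ℝ} [Fact (0 < T)] {p : AddCircle T × AddCircle T → ℝ} (hp : IsDens p)
    {η : ℝ} (hη : 0 < η) : ∃ f : AddCircle T × AddCircle T → ℝ, Measurable f ∧ (∃ R, ∀ x, |f x| ≤ R) ∧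
      ∫ y, Real.log (1 + Real.exp (f y)) ∂torusHaar T - ∫ y, p y * f y ∂torusHaar T ≤
        density T {x | 0 < p x} * Real.log 2 -
          2 * ∫ y in {x | 0 < p x}, (p y - 1 / 2) ^ 2 ∂torusHaar T + η := by
  classical
  have hD : MeasurableSet {x | 0 < p x} := measurableSet_lt measurable_const hp.measurable
  set R := |Real.log η| + 2 with hRdef
  set f : AddCircle T × AddCircle T → ℝ := fun x => if 0 < p x then 4 * (p x - 1 / 2) else -R with hf
  have hfm : Measurable f := Measurable.ite hD
    (measurable_const.mul (hp.measurable.sub measurable_const)) measurable_const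
  have hfb : ∀ x, |f x| ≤ R := by
    intro x
    have h0 := hp.nonneg x
    have h1 := hp.le_one x
    have h2 := abs_nonneg (Real.log η)
    simp only [hf]
    split_ifs
    · rw [abs_le]
      constructor <;> linarith
    · rw [abs_neg, abs_of_nonneg (by linarith)]
  refine ⟨f, hfm, ⟨R, hfb⟩, ?_⟩
  have hpf : Integrable (fun y => p y * f y) (torusHaar T) :=
    Integrable.of_bound (hp.measurable.mul hfm).aestronglyMeasurable R (ae_of_all _ fun x => by
      rw [norm_mul, Real.norm_of_nonneg (hp.nonneg x)]
      exact (mul_le_of_le_one_left (norm_nonneg _) (hp.le_one x)).trans (hfb x))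
  have hsq : Integrable (fun y => (p y - 1 / 2) ^ 2) (torusHaar T) :=
    Integrable.of_bound ((hp.measurable.sub measurable_const).pow_const 2).aestronglyMeasurable 1
      (ae_of_all _ fun x => by
        rw [Real.norm_of_nonneg (sq_nonneg _)]
        nlinarith [hp.nonneg x, hp.le_one x])
  have hE : Real.exp (-R) ≤ η := by
    rw [← Real.le_log_iff_exp_le hη]
    linarith [neg_abs_le (Real.log η)]
  have hi : Integrable (fun y => {x | 0 < p x}.indicator 1 y * Real.log 2 -
      2 * {x | 0 < p x}.indicator (fun y => (p y - 1 / 2) ^ 2) y) (torusHaar T) :=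
    ((isDens_indicator hD).integrable.mul_const _).sub ((hsq.indicator hD).const_mul 2)
  have hmono : ∫ y, (Real.log (1 + Real.exp (f y)) - p y * f y) ∂torusHaar T ≤
      ∫ y, (({x | 0 < p x}.indicator 1 y * Real.log 2 -
        2 * {x | 0 < p x}.indicator (fun y => (p y - 1 / 2) ^ 2) y) + η) ∂torusHaar T := by
    refine integral_mono ((integrable_softplus hfm hfb).sub hpf) (hi.add (integrable_const _)) fun y => ?_
    by_cases hy : 0 < p y
    · have e : f y = 4 * (p y - 1 / 2) := if_pos hy
      have hy' : y ∈ {x | 0 < p x} := hy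
      have := softplus_le (f y)
      simp only [Set.indicator_of_mem hy', Pi.one_apply]
      rw [e] at this ⊢
      nlinarith
    · have e : f y = -R := if_neg hy
      have hy' : y ∉ {x | 0 < p x} := hy
      have := softplus_le_exp (f y)
      have h0 : p y = 0 := le_antisymm (not_lt.1 hy) (hp.nonneg y)
      simp only [Set.indicator_of_notMem hy']
      rw [e] at this ⊢
      rw [h0]
      linarith
  rw [integral_sub (integrable_softplus hfm hfb) hpf] at hmono
  refine hmono.trans_eq ?_
  rw [integral_add hi (integrable_const _),
    integral_sub ((isDens_indicator hD).integrable.mul_const _) ((hsq.indicator hD).const_mul 2),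
    integral_mul_const, integral_indicator_eq_density hD, integral_const_mul,
    integral_indicator hD]
  simp

end

section

variable {T : ℝ} [hT : Fact (0 < T)]

lemma corr_zero_sub_lt {D : Set (AddCircle T × AddCircle T)} (hD : MeasurableSet D) {ε : ℝ} (hε : 0 < ε) :
    ∃ U : Set (AddCircle T × AddCircle T), MeasurableSet U ∧ 0 < (torusHaar T).real U ∧
      ∀ z ∈ U, density T D - ε ≤ corr (D.indicator 1) z := by
  have hc := continuous_corr (isDens_indicator hD)
  refine ⟨{z | density T D - ε < corr (D.indicator 1) z},
    (isOpen_lt continuous_const hc).measurableSet, ?_, fun z hz => le_of_lt hz⟩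
  refine ENNReal.toReal_pos ?_ (measure_ne_top _ _)
  refine ((isOpen_lt continuous_const hc).measure_pos _ ⟨0, ?_⟩).ne'
  rw [Set.mem_ofPred_eq, corr_indicator_zero hD]
  linarith

lemma exists_isCompact_avoiding {D : Set (AddCircle T × AddCircle T)} (hD : MeasurableSet D)
    (h : radialCorr (D.indicator 1) 1 = 0) {τ : ℝ} (hτ : 0 < τ) :
    ∃ C : Set (AddCircle T × AddCircle T), IsCompact C ∧ density T D - τ ≤ (torusHaar T).real C ∧
      ∀ x ∈ C, ∀ θ, x + torusPolar T 1 θ ∉ C := by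
  set μ := torusHaar T with hμ
  have hd := isDens_indicator hD
  obtain ⟨U, hU, hU0, hUc⟩ := corr_zero_sub_lt hD (show 0 < τ / 4 by positivity)
  have hu := isDens_indicator hU
  set g : (AddCircle T × AddCircle T) → (AddCircle T × AddCircle T) → ℝ :=
    fun x z => U.indicator 1 z * D.indicator 1 (z + x) with hg
  have hgd : ∀ x, IsDens (g x) := fun x => hu.mul_comp_add hd x
  have hgm : Measurable (Function.uncurry g) :=
    (hu.measurable.comp measurable_snd).mul
      (hd.measurable.comp (measurable_snd.add measurable_fst))
  have hhm : Measurable fun x => ∫ z, g x z ∂μ :=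
    (hgm.stronglyMeasurable.integral_prod_right (ν := μ)).measurable
  have hUint : ∫ z, U.indicator (1 : AddCircle T × AddCircle T → ℝ) z ∂μ = μ.real U := integral_indicator_one hU
  have hh0 : ∀ x, 0 ≤ ∫ z, g x z ∂μ := fun x => integral_nonneg (hgd x).nonneg
  have hhU : ∀ x, ∫ z, g x z ∂μ ≤ μ.real U := fun x => by
    rw [← hUint]
    exact integral_mono (hgd x).integrable hu.integrable fun z =>
      mul_le_of_le_one_right (hu.nonneg z) (hd.le_one _)
  set E := {x | μ.real U / 2 < ∫ z, g x z ∂μ} with hE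
  have hEm : MeasurableSet E := measurableSet_lt measurable_const hhm
  have hEavoid : ∀ x ∈ E, ∀ θ, x + torusPolar T 1 θ ∉ E := by
    intro x hx θ hy
    have hle : ∫ z, (g x z + g (x + torusPolar T 1 θ) z) ∂μ ≤ μ.real U := by
      rw [← hUint]
      refine integral_mono_ae ((hgd _).integrable.add (hgd _).integrable) hu.integrable ?_
      filter_upwards [ae_mul_eq_zero_of_corr hd (u := x) (v := x + torusPolar T 1 θ)
        (corr_torusPolar_eq_zero hd h θ) (add_sub_cancel_left _ _)] with z hz
      simp only [hg]
      rw [← mul_add]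
      refine mul_le_of_le_one_right (hu.nonneg z) ?_
      have h1 := hd.le_one (z + x)
      have h2 := hd.le_one (z + (x + torusPolar T 1 θ))
      rcases mul_eq_zero.1 hz with h3 | h3 <;> rw [h3] <;> linarith
    rw [integral_add (hgd _).integrable (hgd _).integrable] at hle
    have h1 : μ.real U / 2 < ∫ z, g x z ∂μ := hx
    have h2 : μ.real U / 2 < ∫ z, g (x + torusPolar T 1 θ) z ∂μ := hy
    linarith
  have hfub : ∫ x, D.indicator 1 x * ∫ z, g x z ∂μ ∂μ =
      ∫ z, U.indicator 1 z * corr (D.indicator 1) z ∂μ := by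
    simp_rw [corr, ← integral_const_mul]
    rw [integral_integral_swap]
    · refine integral_congr_ae (ae_of_all _ fun z => integral_congr_ae (ae_of_all _ fun x => ?_))
      simp only [hg]
      rw [add_comm z x]
      ring
    · refine Integrable.of_bound (((hd.measurable.comp measurable_fst).mul
        hgm).aestronglyMeasurable) 1 (ae_of_all _ fun q => ?_)
      simp only [Function.uncurry]
      rw [Real.norm_of_nonneg (mul_nonneg (hd.nonneg _) ((hgd _).nonneg _))]
      exact mul_le_one₀ (hd.le_one _) ((hgd _).nonneg _) ((hgd _).le_one _)
  have hlow : μ.real U * (density T D - τ / 4) ≤ ∫ z, U.indicator 1 z * corr (D.indicator 1) z ∂μ := by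
    rw [← hUint, ← integral_mul_const]
    refine integral_mono (hu.integrable.mul_const _) ?_ fun z => ?_
    · refine (hu.integrable.mul_bdd (c := 1) (continuous_corr hd).aestronglyMeasurable
        (ae_of_all _ fun z => ?_))
      rw [Real.norm_of_nonneg (corr_nonneg hd z)]
      refine (integral_mono (hd.mul_comp_add hd z).integrable (integrable_const 1)
        (hd.mul_comp_add hd z).le_one).trans ?_
      simp
    · by_cases hz : z ∈ U
      · simpa [hz] using hUc z hz
      · simp [hz]
  have hupp : ∫ x, D.indicator 1 x * ∫ z, g x z ∂μ ∂μ ≤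
      ∫ x, (D.indicator 1 x * (μ.real U / 2) + E.indicator 1 x * (μ.real U / 2)) ∂μ := by
    refine integral_mono ?_ ((hd.integrable.mul_const _).add
      ((isDens_indicator hEm).integrable.mul_const _)) fun x => ?_
    · refine hd.integrable.mul_bdd (c := μ.real U) hhm.aestronglyMeasurable (ae_of_all _ fun x => ?_)
      rw [Real.norm_of_nonneg (hh0 x)]
      exact hhU x
    · have h1 := hhU x
      by_cases hx : x ∈ E <;> by_cases hxD : x ∈ D <;> simp only [hx, hxD, Set.indicator_of_mem,
        Set.indicator_of_notMem, not_false_eq_true, Pi.one_apply, one_mul, zero_mul, add_zero,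
        zero_add, le_refl]
      · linarith
      · linarith
      · exact not_lt.1 hx
  rw [integral_add (hd.integrable.mul_const _) ((isDens_indicator hEm).integrable.mul_const _),
    integral_mul_const, integral_mul_const, integral_indicator_eq_density hD,
    integral_indicator_one hEm] at hupp
  have hEd : density T D - τ / 2 ≤ μ.real E := by
    rw [hfub] at hupp
    nlinarith
  obtain ⟨C, hCE, hC, hCm⟩ := hEm.exists_isCompact_lt_add (measure_ne_top μ E)
    (ε := ENNReal.ofReal (τ / 2)) (by simpa using hτ)
  refine ⟨C, hC, ?_, fun x hx θ hy => hEavoid x (hCE hx) θ (hCE hy)⟩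
  have := ENNReal.toReal_mono (by finiteness) hCm.le
  rw [ENNReal.toReal_add (by finiteness) (by finiteness), ENNReal.toReal_ofReal (by positivity)] at this
  change μ.real E ≤ μ.real C + τ / 2 at this
  linarith

end

lemma dist_le_of_mem_gridSquare {K N : ℕ} {v : Fin (N * K) × Fin (N * K)}
    {x y : AddCircle (K : ℝ) × AddCircle (K : ℝ)} (hx : x ∈ gridSquare K N v)
    (hy : y ∈ gridSquare K N v) : dist x y ≤ 1 / N := by
  obtain ⟨p, rfl, h1, h2, h3, h4⟩ := hx
  obtain ⟨q, rfl, h5, h6, h7, h8⟩ := hy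
  rw [add_div] at h2 h4 h6 h8
  have key : ∀ a b : ℝ, |a - b| ≤ 1 / N → dist (a : AddCircle (K : ℝ)) b ≤ 1 / N := by
    intro a b hab
    rw [dist_eq_norm, ← AddCircle.coe_sub]
    exact (AddCircle.norm_coe_le_abs _).trans hab
  exact max_le (key _ _ (abs_le.2 ⟨by linarith, by linarith⟩))
    (key _ _ (abs_le.2 ⟨by linarith, by linarith⟩))

lemma exists_large_isIndep {K : ℕ} [hK : Fact (0 < (K : ℝ))]
    {D : Set (AddCircle (K : ℝ) × AddCircle (K : ℝ))} (hD : MeasurableSet D)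
    (h : radialCorr (D.indicator 1) 1 = 0) {τ : ℝ} (hτ : 0 < τ) :
    ∀ᶠ N : ℕ in atTop, ∃ F : Finset (Fin (N * K) × Fin (N * K)), IsIndep (unitGraph K N) F ∧
      (density K D - τ) * ((N * K : ℕ) : ℝ) ^ 2 ≤ F.card := by
  classical
  obtain ⟨C, hC, hCd, hCa⟩ := exists_isCompact_avoiding hD h hτ
  have hcont : Continuous fun q : (AddCircle (K : ℝ) × AddCircle (K : ℝ)) ×
      (AddCircle (K : ℝ) × AddCircle (K : ℝ)) => torusDist q.1 q.2 := by
    unfold torusDist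
    fun_prop
  have hdisj : Disjoint (C ×ˢ C) {q | torusDist q.1 q.2 = 1} := by
    rw [Set.disjoint_left]
    rintro ⟨x, y⟩ ⟨hx, hy⟩ hxy
    obtain ⟨θ, hθ⟩ := exists_torusPolar_of_torusDist (x := x) (y := y) hxy
    exact hCa x hx θ (hθ ▸ hy)
  obtain ⟨δ, hδ, hthick⟩ := hdisj.exists_thickenings (hC.prod hC) (isClosed_eq hcont continuous_const)
  have hev := (tendsto_const_div_atTop_nhds_zero_nat (1 : ℝ)).eventually_lt_const hδ
  filter_upwards [hev, eventually_gt_atTop 0] with N hNδ hN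
  have hN' : (0 : ℝ) < N := by exact_mod_cast hN
  have hK' := hK.out
  have hnear : ∀ v w, (gridSquare K N v ∩ C).Nonempty → (gridSquare K N w ∩ C).Nonempty →
      ¬ ∃ x ∈ gridSquare K N v, ∃ y ∈ gridSquare K N w, torusDist x y = 1 := by
    rintro v w ⟨x', hx', hx'C⟩ ⟨y', hy', hy'C⟩ ⟨x, hx, y, hy, hxy⟩
    have hmem : (x, y) ∈ Metric.thickening δ (C ×ˢ C) := ?_
    · exact Set.disjoint_left.1 hthick hmem (Metric.self_subset_thickening hδ _ hxy)
    refine Metric.mem_thickening_iff.2 ⟨(x', y'), ⟨hx'C, hy'C⟩, ?_⟩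
    exact (max_le (dist_le_of_mem_gridSquare hx hx') (dist_le_of_mem_gridSquare hy hy')).trans_lt hNδ
  refine ⟨Finset.univ.filter fun v => (gridSquare K N v ∩ C).Nonempty, ?_, ?_⟩
  · intro a ha b hb hab
    rw [Finset.mem_filter] at ha hb
    rcases ((SimpleGraph.fromRel_adj _ _ _).1 hab).2 with h1 | h1
    · exact hnear a b ha.2 hb.2 h1
    · exact hnear b a hb.2 ha.2 h1
  · rw [← le_div_iff₀ (by push_cast; positivity), ← torusHaar_real_unionSquares hN]
    refine hCd.trans (measureReal_mono fun x hx => ?_)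
    obtain ⟨v, hv⟩ := exists_mem_gridSquare hN x
    exact Set.mem_biUnion (Finset.mem_coe.2 (Finset.mem_filter.2 ⟨Finset.mem_univ v, x, hv, hx⟩)) hv

lemma volume_half_disc (c : ℝ × ℝ) :
    volume {p : ℝ × ℝ | (p.1 - c.1) ^ 2 + (p.2 - c.2) ^ 2 < 1 / 4} =
      ENNReal.ofReal (Real.pi / 4) := by
  have hm : MeasurableSet {p : ℝ × ℝ | (p.1 - c.1) ^ 2 + (p.2 - c.2) ^ 2 < 1 / 4} :=
    measurableSet_lt (by fun_prop) (by fun_prop)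
  rw [← Complex.volume_preserving_equiv_real_prod.measure_preimage hm.nullMeasurableSet]
  have : Complex.measurableEquivRealProd ⁻¹'
      {p : ℝ × ℝ | (p.1 - c.1) ^ 2 + (p.2 - c.2) ^ 2 < 1 / 4} =
      Metric.ball (⟨c.1, c.2⟩ : ℂ) (1 / 2) := by
    ext z
    simp only [Set.mem_preimage, Set.mem_ofPred_eq, Complex.measurableEquivRealProd_apply,
      Metric.mem_ball, Complex.dist_eq_re_im]
    rw [Real.sqrt_lt' (by norm_num)]
    norm_num
  rw [this, Complex.volume_ball, ← ENNReal.ofReal_pow (by norm_num),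
    ← ENNReal.ofReal_coe_nnreal, NNReal.coe_real_pi, ← ENNReal.ofReal_mul (by norm_num)]
  congr 1
  ring

lemma volume_biUnion_half_disc {P : Finset (ℝ × ℝ)}
    (hsep : ∀ c ∈ P, ∀ c' ∈ P, c ≠ c' → 4 ≤ (c.1 - c'.1) ^ 2 + (c.2 - c'.2) ^ 2) :
    volume (⋃ c ∈ P, {p : ℝ × ℝ | (p.1 - c.1) ^ 2 + (p.2 - c.2) ^ 2 < 1 / 4}) =
      P.card * ENNReal.ofReal (Real.pi / 4) := by
  rw [measure_biUnion_finset _ fun c _ => measurableSet_lt (by fun_prop) (by fun_prop)]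
  · simp only [volume_half_disc, Finset.sum_const, nsmul_eq_mul]
  · intro c hc c' hc' hcc
    refine Set.disjoint_left.2 fun p h1 h2 => ?_
    simp only [Set.mem_ofPred_eq] at h1 h2
    nlinarith [hsep c hc c' hc' hcc, sq_nonneg (p.1 - c.1 + (p.1 - c'.1)),
      sq_nonneg (p.2 - c.2 + (p.2 - c'.2))]

lemma four_le_sq_sub_period {T a b : ℝ} {m : ℤ} (ha : 1 ≤ a) (ha' : a ≤ T - 1) (hb : 1 ≤ b)
    (hb' : b ≤ T - 1) (hm : m ≠ 0) : 4 ≤ (b - m * T - a) ^ 2 := by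
  rcases lt_or_gt_of_ne hm with h | h
  · have h1 : (m : ℝ) ≤ -1 := by exact_mod_cast Int.le_sub_one_of_lt h
    have : 2 ≤ b - m * T - a := by nlinarith
    nlinarith
  · have h1 : (1 : ℝ) ≤ m := by exact_mod_cast h
    have : b - m * T - a ≤ -2 := by nlinarith
    nlinarith

lemma exists_avoiding_of_separated {T : ℝ} [hT : Fact (0 < T)] (P : Finset (ℝ × ℝ))
    (hbox : ∀ c ∈ P, (1 ≤ c.1 ∧ c.1 ≤ T - 1) ∧ 1 ≤ c.2 ∧ c.2 ≤ T - 1)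
    (hsep : ∀ c ∈ P, ∀ c' ∈ P, c ≠ c' → 4 ≤ (c.1 - c'.1) ^ 2 + (c.2 - c'.2) ^ 2) :
    ∃ D : Set (AddCircle T × AddCircle T), MeasurableSet D ∧ radialCorr (D.indicator 1) 1 = 0 ∧
      P.card * (Real.pi / 4) / T ^ 2 ≤ density T D := by
  have hT0 := hT.out
  set disc : ℝ × ℝ → Set (ℝ × ℝ) := fun c => {p | (p.1 - c.1) ^ 2 + (p.2 - c.2) ^ 2 < 1 / 4}
    with hdisc
  have hopen : ∀ c, IsOpen (disc c) := fun c => isOpen_lt (by fun_prop) (by fun_prop)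
  set B : Set (ℝ × ℝ) := ⋃ c ∈ P, disc c with hB
  have hBo : IsOpen B := isOpen_biUnion fun c _ => hopen c
  set π : ℝ × ℝ → AddCircle T × AddCircle T :=
    Prod.map (QuotientAddGroup.mk) (QuotientAddGroup.mk) with hπ
  have hπo : IsOpenMap π := QuotientAddGroup.isOpenMap_coe.prodMap QuotientAddGroup.isOpenMap_coe
  have hDm : MeasurableSet (π '' B) := (hπo B hBo).measurableSet
  refine ⟨π '' B, hDm, ?_, ?_⟩
  · have key : ∀ θ, corr ((π '' B).indicator 1) (torusPolar T 1 θ) = 0 := by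
      intro θ
      have h0 : ∀ y : AddCircle T × AddCircle T,
          (π '' B).indicator (1 : AddCircle T × AddCircle T → ℝ) y *
            (π '' B).indicator 1 (y + torusPolar T 1 θ) = 0 := by
        intro y
        by_contra hne
        obtain ⟨p, hp, rfl⟩ := Set.mem_of_indicator_ne_zero (left_ne_zero_of_mul hne)
        obtain ⟨q, hq, hqe⟩ := Set.mem_of_indicator_ne_zero (right_ne_zero_of_mul hne)
        obtain ⟨c, hc, hpc⟩ := Set.mem_iUnion₂.1 hp
        obtain ⟨c', hc', hqc⟩ := Set.mem_iUnion₂.1 hq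
        have e1 : ((q.1 - (p.1 + Real.cos θ) : ℝ) : AddCircle T) = 0 := by
          have := congrArg Prod.fst hqe
          simp only [hπ, torusPolar, one_mul, Prod.map_fst, Prod.fst_add] at this
          rw [AddCircle.coe_sub, AddCircle.coe_add, sub_eq_zero]
          exact this
        have e2 : ((q.2 - (p.2 + Real.sin θ) : ℝ) : AddCircle T) = 0 := by
          have := congrArg Prod.snd hqe
          simp only [hπ, torusPolar, one_mul, Prod.map_snd, Prod.snd_add] at this
          rw [AddCircle.coe_sub, AddCircle.coe_add, sub_eq_zero]
          exact this
        obtain ⟨m, hm⟩ := (AddCircle.coe_eq_zero_iff T).1 e1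
        obtain ⟨n, hn⟩ := (AddCircle.coe_eq_zero_iff T).1 e2
        rw [zsmul_eq_mul] at hm hn
        have hcs := Real.cos_sq_add_sin_sq θ
        obtain ⟨⟨b1, b2⟩, b3, b4⟩ := hbox c hc
        obtain ⟨⟨b1', b2'⟩, b3', b4'⟩ := hbox c' hc'
        change (p.1 - c.1) ^ 2 + (p.2 - c.2) ^ 2 < 1 / 4 at hpc
        change (q.1 - c'.1) ^ 2 + (q.2 - c'.2) ^ 2 < 1 / 4 at hqc
        have hw : ((q.1 - c'.1) - (p.1 - c.1)) ^ 2 + ((q.2 - c'.2) - (p.2 - c.2)) ^ 2 < 1 := by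
          nlinarith [sq_nonneg ((q.1 - c'.1) + (p.1 - c.1)), sq_nonneg ((q.2 - c'.2) + (p.2 - c.2))]
        have hlt : (c'.1 - m * T - c.1) ^ 2 + (c'.2 - n * T - c.2) ^ 2 < 4 := by
          have f1 : c'.1 - m * T - c.1 = Real.cos θ - ((q.1 - c'.1) - (p.1 - c.1)) := by
            rw [hm]; ring
          have f2 : c'.2 - n * T - c.2 = Real.sin θ - ((q.2 - c'.2) - (p.2 - c.2)) := by
            rw [hn]; ring
          rw [f1, f2]
          nlinarith [sq_nonneg (Real.cos θ + ((q.1 - c'.1) - (p.1 - c.1))),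
            sq_nonneg (Real.sin θ + ((q.2 - c'.2) - (p.2 - c.2)))]
        have hm0 : m = 0 := by
          by_contra h
          nlinarith [four_le_sq_sub_period b1 b2 b1' b2' h, sq_nonneg (c'.2 - n * T - c.2)]
        have hn0 : n = 0 := by
          by_contra h
          nlinarith [four_le_sq_sub_period b3 b4 b3' b4' h, sq_nonneg (c'.1 - m * T - c.1)]
        subst hm0 hn0
        by_cases hcc : c = c'
        · subst hcc
          have g1 : q.1 - c.1 - (p.1 - c.1) = Real.cos θ := by push_cast at hm; linarith
          have g2 : q.2 - c.2 - (p.2 - c.2) = Real.sin θ := by push_cast at hn; linarith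
          rw [g1, g2] at hw
          linarith
        · have := hsep c hc c' hc' hcc
          push_cast at hlt
          nlinarith
      simp only [corr, h0, integral_zero]
    simp only [radialCorr, key, angleAvg_const]
  · have hpres : MeasurePreserving π
        ((volume : Measure (ℝ × ℝ)).restrict (Set.Ioc 0 (0 + T) ×ˢ Set.Ioc 0 (0 + T))) volume := by
      have := (AddCircle.measurePreserving_mk T 0).prod (AddCircle.measurePreserving_mk T 0)
      rwa [Measure.prod_restrict] at this
    have hsub : B ⊆ π ⁻¹' (π '' B) ∩ (Set.Ioc 0 (0 + T) ×ˢ Set.Ioc 0 (0 + T)) := by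
      intro p hp
      refine ⟨Set.subset_preimage_image _ _ hp, ?_⟩
      obtain ⟨c, hc, hpc⟩ := Set.mem_iUnion₂.1 hp
      change (p.1 - c.1) ^ 2 + (p.2 - c.2) ^ 2 < 1 / 4 at hpc
      obtain ⟨⟨b1, b2⟩, b3, b4⟩ := hbox c hc
      have h1 : |p.1 - c.1| < 1 := abs_lt_of_sq_lt_sq (by nlinarith [sq_nonneg (p.2 - c.2)]) one_pos.le
      have h2 : |p.2 - c.2| < 1 := abs_lt_of_sq_lt_sq (by nlinarith [sq_nonneg (p.1 - c.1)]) one_pos.le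
      rw [abs_lt] at h1 h2
      exact ⟨⟨by linarith, by linarith⟩, by linarith, by linarith⟩
    have hvol : (P.card : ℝ≥0∞) * ENNReal.ofReal (Real.pi / 4) ≤ volume (π '' B) := by
      rw [← hpres.measure_preimage hDm.nullMeasurableSet,
        Measure.restrict_apply' (measurableSet_Ioc.prod measurableSet_Ioc),
        ← volume_biUnion_half_disc hsep]
      exact measure_mono hsub
    rw [density, torusVolume, dif_pos hT0]
    refine div_le_div_of_nonneg_right ?_ (by positivity)
    have := ENNReal.toReal_mono (measure_ne_top _ _) hvol
    rwa [ENNReal.toReal_mul, ENNReal.toReal_natCast, ENNReal.toReal_ofReal (by positivity)] at this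

/-- The centre of the disc indexed by `(i, j)` in the hexagonal packing of discs of radius `1`. -/
noncomputable def hexCentre (v : ℕ × ℕ) : ℝ × ℝ :=
  (2 * v.1 + (v.2 % 2 : ℕ) + 1, √3 * v.2 + 1)

lemma hexCentre_separated {v w : ℕ × ℕ} (h : v ≠ w) :
    4 ≤ ((hexCentre v).1 - (hexCentre w).1) ^ 2 + ((hexCentre v).2 - (hexCentre w).2) ^ 2 := by
  obtain ⟨i, j⟩ := v
  obtain ⟨k, l⟩ := w
  have h3 : √3 ^ 2 = 3 := Real.sq_sqrt (by norm_num)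
  have key : (4 : ℤ) ≤ (2 * i + (j % 2 : ℕ) - (2 * k + (l % 2 : ℕ))) ^ 2 + 3 * ((j : ℤ) - l) ^ 2 := by
    have hij : ¬ (i = k ∧ j = l) := fun e => h (Prod.ext e.1 e.2)
    have sq_ge : ∀ (a b : ℤ), 0 ≤ b → (a ≤ -b ∨ b ≤ a) → b ^ 2 ≤ a ^ 2 := by
      intro a b hb hab
      rcases hab with hab | hab <;> nlinarith
    by_cases hjl : j = l
    · subst hjl
      have := sq_ge (2 * i + (j % 2 : ℕ) - (2 * k + (j % 2 : ℕ))) 2 (by norm_num) (by omega)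
      nlinarith [sq_nonneg ((j : ℤ) - j)]
    · by_cases h1 : (j : ℤ) - l = 1 ∨ (j : ℤ) - l = -1
      · have := sq_ge (2 * i + (j % 2 : ℕ) - (2 * k + (l % 2 : ℕ))) 1 (by norm_num) (by omega)
        have := sq_ge ((j : ℤ) - l) 1 (by norm_num) (by omega)
        linarith
      · have := sq_ge ((j : ℤ) - l) 2 (by norm_num) (by omega)
        nlinarith [sq_nonneg ((2 * i + (j % 2 : ℕ) - (2 * k + (l % 2 : ℕ))) : ℤ)]
  have keyR : (4 : ℝ) ≤ (2 * i + (j % 2 : ℕ) - (2 * k + (l % 2 : ℕ))) ^ 2 + 3 * ((j : ℝ) - l) ^ 2 := by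
    exact_mod_cast key
  simp only [hexCentre]
  calc (4 : ℝ) ≤ _ := keyR
    _ = _ := by linear_combination (-((j : ℝ) - l) ^ 2) * h3

/-- Hexagonally packed discs give `1`-avoiding sets of density close to `π / (8 √3)`. -/
lemma exists_dense_avoiding {K : ℕ} [Fact (0 < (K : ℝ))] (hK : 5000 ≤ K) :
    ∃ D : Set (AddCircle (K : ℝ) × AddCircle (K : ℝ)), MeasurableSet D ∧
      radialCorr (D.indicator 1) 1 = 0 ∧ 0.2265 ≤ density K D := by
  have hKR : (5000 : ℝ) ≤ K := by exact_mod_cast hK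
  have h3 : √3 < 1.7321 := (Real.sqrt_lt' (by norm_num)).2 (by norm_num)
  have h30 : 0 < √3 := by positivity
  have hinj : Function.Injective hexCentre := fun v w hvw => by
    by_contra hne
    have := hexCentre_separated hne
    rw [hvw] at this
    norm_num at this
  set I := (K - 1) / 2 with hI
  set J := ⌊((K : ℝ) - 2) / √3⌋₊ + 1 with hJ
  have hIR : ((K : ℝ) - 2) / 2 ≤ I := by
    have : K ≤ 2 * I + 2 := by omega
    have : (K : ℝ) ≤ 2 * I + 2 := by exact_mod_cast this
    linarith
  have hJR : ((K : ℝ) - 2) / √3 ≤ J := by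
    rw [hJ]; push_cast; exact (Nat.lt_floor_add_one _).le
  obtain ⟨D, hD, h1, h2⟩ := exists_avoiding_of_separated (T := K)
    ((Finset.range I ×ˢ Finset.range J).map ⟨hexCentre, hinj⟩) (by
      intro c hc
      obtain ⟨⟨i, j⟩, hv, rfl⟩ := Finset.mem_map.1 hc
      rw [Finset.mem_product, Finset.mem_range, Finset.mem_range] at hv
      obtain ⟨hi, hj⟩ := hv
      simp only [Function.Embedding.coeFn_mk, hexCentre] at hi hj ⊢
      have e1 : 2 * i + j % 2 + 2 ≤ K := by omega
      have e1' : (2 * i + (j % 2 : ℕ) + 2 : ℝ) ≤ K := by exact_mod_cast e1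
      have e2 : (j : ℝ) ≤ ((K : ℝ) - 2) / √3 :=
        (Nat.le_floor_iff (div_nonneg (by linarith) h30.le)).1 (by omega)
      rw [le_div_iff₀ h30] at e2
      exact ⟨⟨le_add_of_nonneg_left (by positivity), by linarith⟩,
        le_add_of_nonneg_left (by positivity), by linarith⟩) (by
      intro c hc c' hc' hcc
      obtain ⟨v, -, rfl⟩ := Finset.mem_map.1 hc
      obtain ⟨w, -, rfl⟩ := Finset.mem_map.1 hc'
      exact hexCentre_separated fun e => hcc (by rw [e]))
  refine ⟨D, hD, h1, le_trans ?_ h2⟩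
  rw [Finset.card_map, Finset.card_product, Finset.card_range, Finset.card_range,
    le_div_iff₀ (by positivity)]
  have hpi := Real.pi_gt_d4
  have hJ' : ((K : ℝ) - 2) / 1.7321 ≤ J :=
    (div_le_div_of_nonneg_left (by linarith) h30 h3.le).trans hJR
  have hIJ : ((K : ℝ) - 2) / 2 * (((K : ℝ) - 2) / 1.7321) ≤ I * J :=
    mul_le_mul hIR hJ' (div_nonneg (by linarith) (by norm_num)) (by positivity)
  have hK2 : (0.9996 * K) ^ 2 ≤ ((K : ℝ) - 2) ^ 2 := by gcongr; linarith
  push_cast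
  calc (0.2265 : ℝ) * K ^ 2 ≤ ((K : ℝ) - 2) / 2 * (((K : ℝ) - 2) / 1.7321) * (3.1415 / 4) := by
        have e : ((K : ℝ) - 2) / 2 * (((K : ℝ) - 2) / 1.7321) * (3.1415 / 4) =
          ((K : ℝ) - 2) ^ 2 * (3.1415 / 13.8568) := by ring
        have h5 : (0.2267 : ℝ) ≤ 3.1415 / 13.8568 := by norm_num
        have h6 := mul_le_mul hK2 h5 (by norm_num) (sq_nonneg _)
        rw [e]
        nlinarith [sq_nonneg (K : ℝ)]
    _ ≤ I * J * (Real.pi / 4) := by gcongr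

noncomputable section

lemma corr_congr_ae {T : ℝ} [Fact (0 < T)] {p q : AddCircle T × AddCircle T → ℝ}
    (h : p =ᵐ[torusHaar T] q) (x : AddCircle T × AddCircle T) : corr p x = corr q x := by
  refine integral_congr_ae ?_
  have h' := (measurePreserving_add_right (torusHaar T) x).quasiMeasurePreserving.ae_eq_comp h
  filter_upwards [h, h'] with y h1 h2
  simp only [Function.comp_apply] at h2
  rw [h1, h2]

lemma radialCorr_eq_of_ae_half {T : ℝ} [Fact (0 < T)] {p : AddCircle T × AddCircle T → ℝ}
    {D : Set (AddCircle T × AddCircle T)}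
    (h : p =ᵐ[torusHaar T] fun y => 1 / 2 * D.indicator 1 y) (r : ℝ) :
    radialCorr p r = 1 / 4 * radialCorr (D.indicator 1) r := by
  rw [radialCorr, radialCorr, ← angleAvg_const_mul]
  congr 1
  funext θ
  rw [corr_congr_ae h, corr, corr, ← integral_const_mul]
  congr 1
  funext y
  ring

/-- The number of independent sets of `𝒢(N, K)`. -/
def indepCount (K N : ℕ) : ℝ :=
  ({s : Finset (Fin (N * K) × Fin (N * K)) | IsIndep (unitGraph K N) s}.ncard : ℝ)

lemma two_pow_card_le_indepCount {K N : ℕ} {F : Finset (Fin (N * K) × Fin (N * K))}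
    (hF : IsIndep (unitGraph K N) F) : (2 : ℝ) ^ F.card ≤ indepCount K N := by
  have h : (↑F.powerset : Set (Finset (Fin (N * K) × Fin (N * K)))) ⊆
      {s | IsIndep (unitGraph K N) s} := by
    intro s hs a ha b hb
    have hsF := Finset.mem_powerset.1 (Finset.mem_coe.1 hs)
    exact hF a (hsF ha) b (hsF hb)
  have := Set.ncard_le_ncard h (Set.toFinite _)
  rw [Set.ncard_coe_finset, Finset.card_powerset] at this
  rw [indepCount]
  exact_mod_cast this

lemma indepCount_pos (K N : ℕ) : 0 < indepCount K N := by
  have := two_pow_card_le_indepCount (K := K) (N := N) (F := ∅) (by simp [IsIndep])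
  simp only [Finset.card_empty, pow_zero] at this
  linarith

lemma ncard_le_add_of_subset_union {α : Type*} [Finite α] {s t u : Set α} (h : s ⊆ t ∪ u) :
    (s.ncard : ℝ) ≤ t.ncard + u.ncard := by
  exact_mod_cast (Set.ncard_le_ncard h (Set.toFinite _)).trans (Set.ncard_union_le t u)

section

variable {K : ℕ}

/-- The density function of the union of the squares in `I`. -/
def squaresDens (N : ℕ) (I : Finset (Fin (N * K) × Fin (N * K))) : Dens (K : ℝ) :=
  ⟨(unionSquares K N I).indicator 1, isDens_indicator (measurableSet_unionSquares K N I)⟩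

/-- The proportion of the independent sets of `𝒢(N, K)` that lie in `S` and have small pair
correlation at distance `1.96`. -/
def badRatio (S : Set (Dens (K : ℝ))) (N : ℕ) : ℝ :=
  ({I : Finset (Fin (N * K) × Fin (N * K)) | (IsIndep (unitGraph K N) I ∧
    ¬ 1 + 0.0005 ≤ scorr (K : ℝ) (unionSquares K N I) 1.96) ∧ squaresDens N I ∈ S}.ncard : ℝ) /
    indepCount K N

lemma badRatio_nonneg (S : Set (Dens (K : ℝ))) (N : ℕ) : 0 ≤ badRatio S N :=
  div_nonneg (Nat.cast_nonneg _) (indepCount_pos K N).le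

lemma badRatio_mono {S S' : Set (Dens (K : ℝ))} (h : S ⊆ S') (N : ℕ) :
    badRatio S N ≤ badRatio S' N := by
  refine div_le_div_of_nonneg_right ?_ (indepCount_pos K N).le
  refine Nat.cast_le.2 (Set.ncard_le_ncard (fun I hI => ?_) (Set.toFinite _))
  exact ⟨hI.1, h hI.2⟩

lemma badRatio_union_le (S S' : Set (Dens (K : ℝ))) (N : ℕ) :
    badRatio (S ∪ S') N ≤ badRatio S N + badRatio S' N := by
  rw [badRatio, badRatio, badRatio, ← add_div]
  refine div_le_div_of_nonneg_right ?_ (indepCount_pos K N).le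
  refine ncard_le_add_of_subset_union fun I hI => ?_
  exact hI.2.imp (fun h => ⟨hI.1, h⟩) fun h => ⟨hI.1, h⟩

lemma badRatio_eq_zero {S : Set (Dens (K : ℝ))} {N : ℕ}
    (h : ∀ I, IsIndep (unitGraph K N) I → squaresDens N I ∈ S →
      1 + 0.0005 ≤ scorr (K : ℝ) (unionSquares K N I) 1.96) : badRatio S N = 0 := by
  rw [badRatio, (Set.ncard_eq_zero (Set.toFinite _)).2, Nat.cast_zero, zero_div]
  exact Set.eq_empty_of_forall_notMem fun I hI => hI.1.2 (h I hI.1.1 hI.2)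

variable [hK : Fact (0 < (K : ℝ))]

lemma eventually_exp_le_indepCount {D : Set (AddCircle (K : ℝ) × AddCircle (K : ℝ))}
    (hD : MeasurableSet D) (h : radialCorr (D.indicator 1) 1 = 0) {a : ℝ}
    (ha : a < density K D * Real.log 2) :
    ∀ᶠ N : ℕ in atTop, Real.exp (((N * K : ℕ) : ℝ) ^ 2 * a) ≤ indepCount K N := by
  have hl : 0 < Real.log 2 := Real.log_pos (by norm_num)
  have hτ : 0 < density K D - a / Real.log 2 := by
    rw [sub_pos, div_lt_iff₀ hl]
    exact ha
  filter_upwards [exists_large_isIndep hD h hτ] with N hN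
  obtain ⟨F, hF, hc⟩ := hN
  refine le_trans ?_ (two_pow_card_le_indepCount hF)
  rw [← Real.exp_log (show (0 : ℝ) < 2 ^ F.card by positivity), Real.log_pow, Real.exp_le_exp]
  rw [sub_sub_cancel] at hc
  calc ((N * K : ℕ) : ℝ) ^ 2 * a = a / Real.log 2 * ((N * K : ℕ) : ℝ) ^ 2 * Real.log 2 := by
        field_simp
    _ ≤ F.card * Real.log 2 := by gcongr

/-- Densities of entropy below that of some `1`-avoiding set are negligible. -/
lemma exists_nhds_badRatio_of_entropy (p : Dens (K : ℝ))
    {D : Set (AddCircle (K : ℝ) × AddCircle (K : ℝ))} (hD : MeasurableSet D)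
    (h : radialCorr (D.indicator 1) 1 = 0)
    (hlt : density K {x | 0 < p.1 x} * Real.log 2 -
      2 * ∫ y in {x | 0 < p.1 x}, (p.1 y - 1 / 2) ^ 2 ∂torusHaar (K : ℝ) <
        density K D * Real.log 2) :
    ∃ S ∈ 𝓝 p, Tendsto (badRatio S) atTop (𝓝 0) := by
  classical
  set e := density K {x | 0 < p.1 x} * Real.log 2 -
    2 * ∫ y in {x | 0 < p.1 x}, (p.1 y - 1 / 2) ^ 2 ∂torusHaar (K : ℝ) with he
  obtain ⟨g, hg0, hg⟩ : ∃ g : ℝ, 0 < g ∧ e + 4 * g = density K D * Real.log 2 :=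
    ⟨(density K D * Real.log 2 - e) / 4, by linarith, by ring⟩
  obtain ⟨f, hf, ⟨R, hR⟩, hfe⟩ := exists_tilt p.2 hg0
  have hfL : MemLp f 2 (torusHaar (K : ℝ)) :=
    MemLp.of_bound hf.aestronglyMeasurable R (ae_of_all _ hR)
  refine ⟨{q | ∫ y, p.1 y * f y ∂torusHaar (K : ℝ) - g < ∫ y, q.1 y * f y ∂torusHaar (K : ℝ)},
    (isOpen_lt continuous_const (Dens.continuous_integral hfL)).mem_nhds
      (sub_lt_self _ hg0), ?_⟩
  set c := ∫ y, p.1 y * f y ∂torusHaar (K : ℝ) - g with hc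
  have hlim : Tendsto (fun N : ℕ => Real.exp (-(((N * K : ℕ) : ℝ) ^ 2 * g))) atTop (𝓝 0) := by
    refine Real.tendsto_exp_neg_atTop_nhds_zero.comp (Tendsto.atTop_mul_const hg0 ?_)
    refine (tendsto_pow_atTop two_ne_zero).comp ?_
    refine tendsto_natCast_atTop_atTop.comp (tendsto_id.atTop_mul_const' ?_)
    exact_mod_cast hK.out
  refine squeeze_zero' (Eventually.of_forall fun N => badRatio_nonneg _ N) ?_ hlim
  filter_upwards [eventually_exp_le_indepCount hD h (a := e + 3 * g) (by linarith),
    eventually_gt_atTop 0] with N hN hN0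
  rw [badRatio, div_le_iff₀ (indepCount_pos K N)]
  rw [Set.ncard_eq_toFinset_card _ (Set.toFinite _)]
  refine (card_le_exp_tilt hN0 hf hR _ (c := c) ?_).trans ?_
  · intro I hI
    exact le_of_lt ((Set.Finite.mem_toFinset _).1 hI).2
  · refine le_trans ?_ (mul_le_mul_of_nonneg_left hN (Real.exp_pos _).le)
    rw [← Real.exp_add, Real.exp_le_exp]
    have : ∫ y, Real.log (1 + Real.exp (f y)) ∂torusHaar (K : ℝ) - c ≤ e + 2 * g := by linarith
    nlinarith [mul_le_mul_of_nonneg_left this (sq_nonneg ((N * K : ℕ) : ℝ))]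

lemma ae_eq_half_indicator {p : AddCircle (K : ℝ) × AddCircle (K : ℝ) → ℝ} (hp : IsDens p)
    (h : ∫ y in {x | 0 < p x}, (p y - 1 / 2) ^ 2 ∂torusHaar (K : ℝ) ≤ 0) :
    p =ᵐ[torusHaar (K : ℝ)] fun y => 1 / 2 * {x | 0 < p x}.indicator 1 y := by
  have hD : MeasurableSet {x | 0 < p x} := measurableSet_lt measurable_const hp.measurable
  have hint : IntegrableOn (fun y => (p y - 1 / 2) ^ 2) {x | 0 < p x} (torusHaar (K : ℝ)) := by
    refine (Integrable.of_bound ((hp.measurable.sub_const _).pow_const 2).aestronglyMeasurable 1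
      (ae_of_all _ fun y => ?_)).integrableOn
    rw [Real.norm_of_nonneg (sq_nonneg _)]
    nlinarith [hp.nonneg y, hp.le_one y]
  have h0 := (setIntegral_eq_zero_iff_of_nonneg_ae (ae_of_all _ fun y => sq_nonneg _) hint).1
    (le_antisymm h (integral_nonneg fun y => sq_nonneg _))
  have h1 := (ae_restrict_iff' hD).1 h0
  filter_upwards [h1] with y hy
  by_cases hyD : y ∈ {x | 0 < p x}
  · have := hy hyD
    simp only [Pi.zero_apply, pow_eq_zero_iff two_ne_zero] at this
    rw [Set.indicator_of_mem hyD, Pi.one_apply]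
    linarith
  · rw [Set.indicator_of_notMem hyD, mul_zero]
    exact le_antisymm (not_lt.1 hyD) (hp.nonneg y)

lemma exists_nhds_badRatio (hK5 : 5000 ≤ K) (p : Dens (K : ℝ)) :
    ∃ S ∈ 𝓝 p, Tendsto (badRatio S) atTop (𝓝 0) := by
  have hl : 0 < Real.log 2 := Real.log_pos (by norm_num)
  have hDm : MeasurableSet {x | 0 < p.1 x} := measurableSet_lt measurable_const p.2.measurable
  have hr0 : 0 ≤ radialCorr p.1 1 := by
    rw [radialCorr, ← angleAvg_const 0]
    exact angleAvg_mono continuous_const ((continuous_corr p.2).comp (continuous_torusPolar 1))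
      fun θ => corr_nonneg p.2 _
  rcases hr0.lt_or_eq with h1 | h1
  · refine ⟨{q | 0 < radialCorr q.1 1},
      (isOpen_lt continuous_const (continuous_radialCorr one_pos)).mem_nhds h1, ?_⟩
    refine tendsto_const_nhds.congr' ?_
    filter_upwards [eventually_ge_atTop 2] with N hN
    refine (badRatio_eq_zero fun I hI hS => absurd ?_ (lt_irrefl (0 : ℝ))).symm
    refine hS.trans_eq ?_
    exact radialCorr_unionSquares_eq_zero hN (by omega) hI
  · have hD0 := radialCorr_support_eq_zero p.2 h1.symm
    have hσ : 0 ≤ ∫ y in {x | 0 < p.1 x}, (p.1 y - 1 / 2) ^ 2 ∂torusHaar (K : ℝ) :=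
      integral_nonneg fun y => sq_nonneg _
    rcases hσ.lt_or_eq with h2 | h2
    · exact exists_nhds_badRatio_of_entropy p hDm hD0 (by linarith)
    rcases lt_or_ge (density K {x | 0 < p.1 x}) 0.2264 with h3 | h3
    · obtain ⟨D, hD, hD1, hD2⟩ := exists_dense_avoiding hK5
      exact exists_nhds_badRatio_of_entropy p hD hD1 (by rw [← h2]; nlinarith)
    have hae := ae_eq_half_indicator p.2 h2.ge
    have hR := le_radialCorr_of_density hDm hD0 h3
    have hr := radialCorr_eq_of_ae_half hae 1.96
    have hi : ∫ y, p.1 y * 1 ∂torusHaar (K : ℝ) = 1 / 2 * density K {x | 0 < p.1 x} := by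
      simp only [mul_one]
      rw [integral_congr_ae hae, integral_const_mul, integral_indicator_eq_density hDm]
    have hc : Continuous fun q : Dens (K : ℝ) => ∫ y, q.1 y * 1 ∂torusHaar (K : ℝ) :=
      Dens.continuous_integral (memLp_const 1)
    have hc' : Continuous fun q : Dens (K : ℝ) =>
      (1 + 0.0005) * (∫ y, q.1 y * 1 ∂torusHaar (K : ℝ)) ^ 2 := continuous_const.mul (hc.pow 2)
    refine ⟨{q | 0 < ∫ y, q.1 y * 1 ∂torusHaar (K : ℝ)} ∩
      {q | (1 + 0.0005) * (∫ y, q.1 y * 1 ∂torusHaar (K : ℝ)) ^ 2 < radialCorr q.1 1.96},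
      inter_mem ((isOpen_lt continuous_const hc).mem_nhds ?_)
        ((isOpen_lt hc'
          (continuous_radialCorr (by norm_num))).mem_nhds ?_), ?_⟩
    · rw [Set.mem_ofPred_eq, hi]
      linarith
    · rw [Set.mem_ofPred_eq, hi, hr]
      nlinarith
    · refine tendsto_const_nhds.congr fun N => (badRatio_eq_zero fun I hI hS => ?_).symm
      obtain ⟨hS1, hS2⟩ := hS
      have hm := measurableSet_unionSquares K N I
      have e : ∫ y, (squaresDens N I).1 y * 1 ∂torusHaar (K : ℝ) =
          density K (unionSquares K N I) := by
        simp only [mul_one]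
        exact integral_indicator_eq_density hm
      rw [Set.mem_ofPred_eq, e] at hS1 hS2
      rw [show radialCorr (squaresDens N I).1 1.96 = _ from radialCorr_indicator hm 1.96] at hS2
      rw [scorr, le_div_iff₀ (by positivity)]
      exact hS2.le

lemma tendsto_badRatio (hK5 : 5000 ≤ K) :
    Tendsto (badRatio (Set.univ : Set (Dens (K : ℝ)))) atTop (𝓝 0) := by
  refine isCompact_univ.induction_on (p := fun S => Tendsto (badRatio S) atTop (𝓝 0)) ?_ ?_ ?_ ?_
  · exact tendsto_const_nhds.congr fun N => (badRatio_eq_zero fun I _ hS => hS.elim).symm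
  · exact fun S S' hSS h => squeeze_zero (badRatio_nonneg S) (badRatio_mono hSS) h
  · intro S S' h h'
    exact squeeze_zero (badRatio_nonneg _) (badRatio_union_le S S') (by simpa using h.add h')
  · intro p _
    simpa only [nhdsWithin_univ] using exists_nhds_badRatio hK5 p

end

end

/-- There exist `γ > 0` and `K₀ > 0` such that for every integer `K > K₀` and every `ε > 0`
there is `N₀ = N₀(K, ε)` such that for every integer `N > N₀`: if `A` is chosen uniformly at
random among the independent sets of `𝒢(N, K)`, then with probability at least `1 - ε` the
associated union of squares `A_A ⊆ 𝕋_K²` satisfies `s(1.96; A_A) ≥ 1 + γ`. -/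
theorem typical_independent_sets_cluster :
    ∃ γ > (0:ℝ), ∃ K₀ : ℕ, 0 < K₀ ∧ ∀ K : ℕ, K₀ < K → ∀ ε > (0:ℝ), ∃ N₀ : ℕ, ∀ N : ℕ, N₀ < N →
      (1 - ε) * ({s : Finset (Fin (N * K) × Fin (N * K)) |
            IsIndep (unitGraph K N) s}.ncard : ℝ) ≤
        ({s : Finset (Fin (N * K) × Fin (N * K)) | IsIndep (unitGraph K N) s ∧
            1 + γ ≤ scorr (K : ℝ) (unionSquares K N s) 1.96}.ncard : ℝ) := by
  refine ⟨0.0005, by norm_num, 5000, by norm_num, fun K hK ε hε => ?_⟩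
  have : Fact (0 < (K : ℝ)) := ⟨by exact_mod_cast (by omega : 0 < K)⟩
  obtain ⟨N₀, hN₀⟩ := eventually_atTop.1
    ((tendsto_badRatio hK.le).eventually_le_const hε)
  refine ⟨N₀, fun N hN => ?_⟩
  have hb := hN₀ N hN.le
  rw [badRatio, div_le_iff₀ (indepCount_pos K N), indepCount] at hb
  have hsplit : ({s : Finset (Fin (N * K) × Fin (N * K)) | IsIndep (unitGraph K N) s}.ncard : ℝ) ≤
      ({s : Finset (Fin (N * K) × Fin (N * K)) | IsIndep (unitGraph K N) s ∧
        1 + 0.0005 ≤ scorr (K : ℝ) (unionSquares K N s) 1.96}.ncard : ℝ) +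
      ({s : Finset (Fin (N * K) × Fin (N * K)) | (IsIndep (unitGraph K N) s ∧
        ¬ 1 + 0.0005 ≤ scorr (K : ℝ) (unionSquares K N s) 1.96) ∧
          squaresDens N s ∈ (Set.univ : Set (Dens (K : ℝ)))}.ncard : ℝ) := by
    refine ncard_le_add_of_subset_union fun s hs => ?_
    by_cases h : 1 + 0.0005 ≤ scorr (K : ℝ) (unionSquares K N s) 1.96
    · exact Or.inl ⟨hs, h⟩
    · exact Or.inr ⟨⟨hs, h⟩, Set.mem_univ _⟩
  linarith
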